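/- Let p > 2. There exists a constant C > 0 such that for every ε > 0 and every smooth compactly supported f: ℝ³ → ℝ, the super-Poincaré inequality ∫ f² dμ ≤ ε ∫ |∇_ℍ f|² dμ + exp(C(1 + ε^{−p/(p−2)})) (∫ |f| dμ)² holds; in particular μ satisfies a 2-super-Poincaré inequality with ε₀ = 0 and growth function β₂(ε) ∼ exp(C ε^{−p/(p−2)}). -/

import Mathlib

open MeasureTheory

/-- Horizontal vector field `X₁ = ∂_{x₁} - (x₂/2) ∂_t` on the Heisenberg group `ℝ³`. -/
noncomputable def X1 (f : ℝ × ℝ × ℝ → ℝ) (w : ℝ × ℝ × ℝ) : ℝ :=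
  fderiv ℝ f w (1, 0, -(w.2.1) / 2)

/-- Horizontal vector field `X₂ = ∂_{x₂} + (x₁/2) ∂_t` on the Heisenberg group `ℝ³`. -/
noncomputable def X2 (f : ℝ × ℝ × ℝ → ℝ) (w : ℝ × ℝ × ℝ) : ℝ :=
  fderiv ℝ f w (0, 1, w.1 / 2)

/-- The Kaplan norm `N(x₁,x₂,t) = ((x₁² + x₂²)² + 16 t²)^{1/4}` on the Heisenberg group. -/
noncomputable def KaplanH (w : ℝ × ℝ × ℝ) : ℝ :=
  ((w.1 ^ 2 + w.2.1 ^ 2) ^ 2 + 16 * w.2.2 ^ 2) ^ ((1 : ℝ) / 4)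

/-- The probability measure `dμ = Z⁻¹ e^{-N^p} dξ` on the Heisenberg group `ℝ³`. -/
noncomputable def muH (p : ℝ) : Measure (ℝ × ℝ × ℝ) :=
  volume.withDensity (fun w => ENNReal.ofReal
    ((∫ v : ℝ × ℝ × ℝ, Real.exp (-(KaplanH v) ^ p))⁻¹ * Real.exp (-(KaplanH w) ^ p)))

lemma isAddHaarMeasure_volume_real_prod_real :
    (volume : Measure (ℝ × ℝ)).IsAddHaarMeasure :=
  inferInstanceAs (Measure.IsAddHaarMeasure ((volume : Measure ℝ).prod (volume : Measure ℝ)))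

lemma isAddHaarMeasure_volume_real_prod_real_prod_real :
    (volume : Measure (ℝ × ℝ × ℝ)).IsAddHaarMeasure :=
  have := isAddHaarMeasure_volume_real_prod_real
  inferInstanceAs (Measure.IsAddHaarMeasure ((volume : Measure ℝ).prod (volume : Measure (ℝ × ℝ))))

lemma integrable_of_continuous_of_eq_zero {f F : ℝ × ℝ × ℝ → ℝ} (hF : Continuous F)
    (hc : HasCompactSupport f) (h : ∀ w, f w = 0 → F w = 0) : Integrable F :=
  hF.integrable_of_hasCompactSupport (hc.mono fun w hw hf => hw (h w hf))

section HorizontalCalculus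

variable {F G : ℝ × ℝ × ℝ → ℝ} {w : ℝ × ℝ × ℝ}

lemma X1_mul (hF : DifferentiableAt ℝ F w) (hG : DifferentiableAt ℝ G w) :
    X1 (fun v => F v * G v) w = F w * X1 G w + X1 F w * G w := by
  simp only [X1]
  rw [fderiv_fun_mul hF hG]
  simp [mul_comm]

lemma X2_mul (hF : DifferentiableAt ℝ F w) (hG : DifferentiableAt ℝ G w) :
    X2 (fun v => F v * G v) w = F w * X2 G w + X2 F w * G w := by
  simp only [X2]
  rw [fderiv_fun_mul hF hG]
  simp [mul_comm]

lemma X1_sub (hF : DifferentiableAt ℝ F w) (hG : DifferentiableAt ℝ G w) :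
    X1 (fun v => F v - G v) w = X1 F w - X1 G w := by
  simp only [X1]
  rw [fderiv_fun_sub hF hG]
  simp

lemma X2_sub (hF : DifferentiableAt ℝ F w) (hG : DifferentiableAt ℝ G w) :
    X2 (fun v => F v - G v) w = X2 F w - X2 G w := by
  simp only [X2]
  rw [fderiv_fun_sub hF hG]
  simp

lemma X1_comp {φ : ℝ → ℝ} {a : ℝ} (hφ : HasDerivAt φ a (F w)) (hF : DifferentiableAt ℝ F w) :
    X1 (fun v => φ (F v)) w = a * X1 F w := by
  have h : HasFDerivAt (fun v => φ (F v)) _ w := hφ.comp_hasFDerivAt w hF.hasFDerivAt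
  simp [X1, h.fderiv]

lemma X2_comp {φ : ℝ → ℝ} {a : ℝ} (hφ : HasDerivAt φ a (F w)) (hF : DifferentiableAt ℝ F w) :
    X2 (fun v => φ (F v)) w = a * X2 F w := by
  have h : HasFDerivAt (fun v => φ (F v)) _ w := hφ.comp_hasFDerivAt w hF.hasFDerivAt
  simp [X2, h.fderiv]

lemma continuous_X1 (hF : ContDiff ℝ 1 F) : Continuous (X1 F) :=
  (hF.continuous_fderiv one_ne_zero).clm_apply (by fun_prop)

lemma continuous_X2 (hF : ContDiff ℝ 1 F) : Continuous (X2 F) :=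
  (hF.continuous_fderiv one_ne_zero).clm_apply (by fun_prop)

lemma hasCompactSupport_X1 (hF : HasCompactSupport F) : HasCompactSupport (X1 F) :=
  (hF.fderiv ℝ).mono fun v hv h => hv (by simp [X1, h])

lemma hasCompactSupport_X2 (hF : HasCompactSupport F) : HasCompactSupport (X2 F) :=
  (hF.fderiv ℝ).mono fun v hv h => hv (by simp [X2, h])

lemma integral_mul_fderiv_eq_zero (hF : ContDiff ℝ 1 F) (hc : HasCompactSupport F)
    {c : ℝ × ℝ × ℝ → ℝ} (hcd : ContDiff ℝ 1 c) {v : ℝ × ℝ × ℝ} (hv : ∀ w, fderiv ℝ c w v = 0) :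
    ∫ w, c w * fderiv ℝ F w v = 0 := by
  have hd : Continuous fun w => fderiv ℝ F w v :=
    (hF.continuous_fderiv one_ne_zero).clm_apply continuous_const
  have hdc : HasCompactSupport fun w => fderiv ℝ F w v := hc.fderiv_apply ℝ v
  have := isAddHaarMeasure_volume_real_prod_real_prod_real
  rw [integral_mul_fderiv_eq_neg_fderiv_mul_of_integrable]
  · simp [hv]
  · simp [hv]
  · exact (hcd.continuous.mul hd).integrable_of_hasCompactSupport hdc.mul_left
  · exact (hcd.continuous.mul hF.continuous).integrable_of_hasCompactSupport hc.mul_left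
  · exact fun x _ => hcd.differentiable one_ne_zero x
  · exact fun x _ => hF.differentiable one_ne_zero x

lemma integral_X1_eq_zero (hF : ContDiff ℝ 1 F) (hc : HasCompactSupport F) :
    ∫ w, X1 F w = 0 := by
  have hd (v : ℝ × ℝ × ℝ) : Continuous fun w => fderiv ℝ F w v :=
    (hF.continuous_fderiv one_ne_zero).clm_apply continuous_const
  have hdc (v : ℝ × ℝ × ℝ) : HasCompactSupport fun w => fderiv ℝ F w v := hc.fderiv_apply ℝ v
  have key : X1 F = fun w => 1 * fderiv ℝ F w (1, 0, 0) +
      (-w.2.1 / 2) * fderiv ℝ F w (0, 0, 1) := by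
    ext w
    rw [X1, one_mul, ← smul_eq_mul (-w.2.1 / 2), ← map_smul, ← map_add]
    simp
  have h1 := integral_mul_fderiv_eq_zero hF hc (c := fun _ => 1) (v := (1, 0, 0))
    (by fun_prop) (by simp)
  have h2 := integral_mul_fderiv_eq_zero hF hc (c := fun w => -w.2.1 / 2) (v := (0, 0, 1))
    (by fun_prop) (fun w => by
      have h : HasFDerivAt (fun w : ℝ × ℝ × ℝ => -w.2.1 / 2) _ w :=
        ((hasFDerivAt_snd (𝕜 := ℝ) (p := w)).fst.neg.mul_const (2 : ℝ)⁻¹)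
      rw [h.fderiv]; simp)
  rw [key, integral_add, h1, h2, add_zero]
  · exact (continuous_const.mul (hd _)).integrable_of_hasCompactSupport (hdc _).mul_left
  · exact (Continuous.mul (by fun_prop) (hd _)).integrable_of_hasCompactSupport (hdc _).mul_left

lemma integral_X2_eq_zero (hF : ContDiff ℝ 1 F) (hc : HasCompactSupport F) :
    ∫ w, X2 F w = 0 := by
  have hd (v : ℝ × ℝ × ℝ) : Continuous fun w => fderiv ℝ F w v :=
    (hF.continuous_fderiv one_ne_zero).clm_apply continuous_const
  have hdc (v : ℝ × ℝ × ℝ) : HasCompactSupport fun w => fderiv ℝ F w v := hc.fderiv_apply ℝ v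
  have key : X2 F = fun w => 1 * fderiv ℝ F w (0, 1, 0) +
      (w.1 / 2) * fderiv ℝ F w (0, 0, 1) := by
    ext w
    rw [X2, one_mul, ← smul_eq_mul (w.1 / 2), ← map_smul, ← map_add]
    simp
  have h1 := integral_mul_fderiv_eq_zero hF hc (c := fun _ => 1) (v := (0, 1, 0))
    (by fun_prop) (by simp)
  have h2 := integral_mul_fderiv_eq_zero hF hc (c := fun w => w.1 / 2) (v := (0, 0, 1))
    (by fun_prop) (fun w => by
      have h : HasFDerivAt (fun w : ℝ × ℝ × ℝ => w.1 / 2) _ w :=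
        ((hasFDerivAt_fst (𝕜 := ℝ) (p := w)).mul_const (2 : ℝ)⁻¹)
      rw [h.fderiv]; simp)
  rw [key, integral_add, h1, h2, add_zero]
  · exact (continuous_const.mul (hd _)).integrable_of_hasCompactSupport (hdc _).mul_left
  · exact (Continuous.mul (by fun_prop) (hd _)).integrable_of_hasCompactSupport (hdc _).mul_left

end HorizontalCalculus

section HorizontalFlows

lemma sq_intervalIntegral_le_mul {h : ℝ → ℝ} (hh : Continuous h) {a : ℝ} (ha : 0 ≤ a) :
    (∫ s in (0 : ℝ)..a, h s) ^ 2 ≤ a * ∫ s in (0 : ℝ)..a, h s ^ 2 := by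
  rcases ha.eq_or_lt with rfl | ha'
  · simp
  set I := ∫ s in (0 : ℝ)..a, h s with hI
  have h0 : 0 ≤ ∫ s in (0 : ℝ)..a, (h s - I / a) ^ 2 :=
    intervalIntegral.integral_nonneg ha fun s _ => sq_nonneg _
  have h1 : ∫ s in (0 : ℝ)..a, (h s - I / a) ^ 2 =
      (∫ s in (0 : ℝ)..a, h s ^ 2) - 2 * (I / a) * I + a * (I / a) ^ 2 := by
    have : ∀ s, (h s - I / a) ^ 2 = h s ^ 2 - 2 * (I / a) * h s + (I / a) ^ 2 := fun s => by ring
    simp_rw [this]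
    rw [intervalIntegral.integral_add, intervalIntegral.integral_sub,
      intervalIntegral.integral_const_mul, intervalIntegral.integral_const, ← hI]
    · simp
    all_goals exact Continuous.intervalIntegrable (by fun_prop) _ _
  rw [h1] at h0
  have h2 : a * ((∫ s in (0 : ℝ)..a, h s ^ 2) - 2 * (I / a) * I + a * (I / a) ^ 2) =
      a * (∫ s in (0 : ℝ)..a, h s ^ 2) - I ^ 2 := by
    field_simp
    ring
  nlinarith [mul_nonneg ha h0]

lemma lintegral_sq_sub_flow_le {Φ : ℝ → ℝ × ℝ × ℝ → ℝ × ℝ × ℝ}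
    (hΦ : Continuous (Function.uncurry Φ)) (hmp : ∀ s, MeasurePreserving (Φ s) volume volume)
    (hΦ0 : ∀ w, Φ 0 w = w) {g h : ℝ × ℝ × ℝ → ℝ} (hh : Continuous h)
    (hd : ∀ s w, HasDerivAt (fun s => g (Φ s w)) (h (Φ s w)) s) {a : ℝ} (ha : 0 ≤ a) :
    ∫⁻ w, ENNReal.ofReal ((g (Φ a w) - g w) ^ 2) ≤
      ENNReal.ofReal (a ^ 2) * ∫⁻ w, ENNReal.ofReal (h w ^ 2) := by
  have hc : Continuous fun q : ℝ × ℝ × ℝ × ℝ => h (Φ q.1 q.2) := hh.comp hΦ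
  have hcw (w) : Continuous fun s => h (Φ s w) :=
    hc.comp (continuous_id.prodMk continuous_const)
  have hpt (w) : ENNReal.ofReal ((g (Φ a w) - g w) ^ 2) ≤
      ENNReal.ofReal a * ∫⁻ s in Set.Ioc 0 a, ENNReal.ofReal (h (Φ s w) ^ 2) := by
    rw [← ofReal_integral_eq_lintegral_ofReal, ← ENNReal.ofReal_mul ha]
    · refine ENNReal.ofReal_le_ofReal ?_
      have := intervalIntegral.integral_eq_sub_of_hasDerivAt (a := 0) (b := a)
        (fun s _ => hd s w) ((hcw w).intervalIntegrable _ _)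
      rw [hΦ0] at this
      rw [← this, ← intervalIntegral.integral_of_le ha]
      exact sq_intervalIntegral_le_mul (hcw w) ha
    · exact (((hcw w).pow 2).intervalIntegrable 0 a).1
    · exact Filter.Eventually.of_forall fun s => sq_nonneg _
  have hm : Measurable (Function.uncurry fun (w : ℝ × ℝ × ℝ) s =>
      ENNReal.ofReal (h (Φ s w) ^ 2)) :=
    (ENNReal.continuous_ofReal.comp ((hc.comp continuous_swap).pow 2)).measurable
  calc ∫⁻ w, ENNReal.ofReal ((g (Φ a w) - g w) ^ 2)
      ≤ ∫⁻ w, ENNReal.ofReal a * ∫⁻ s in Set.Ioc 0 a, ENNReal.ofReal (h (Φ s w) ^ 2) :=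
        lintegral_mono hpt
    _ = ENNReal.ofReal a * ∫⁻ s in Set.Ioc 0 a, ∫⁻ w, ENNReal.ofReal (h (Φ s w) ^ 2) := by
        rw [lintegral_const_mul' _ _ ENNReal.ofReal_ne_top, lintegral_lintegral_swap hm.aemeasurable]
    _ = ENNReal.ofReal a * ∫⁻ _ in Set.Ioc 0 a, ∫⁻ w, ENNReal.ofReal (h w ^ 2) := by
        congr 2
        ext s
        exact (hmp s).lintegral_comp (f := fun w => ENNReal.ofReal (h w ^ 2))
          (ENNReal.continuous_ofReal.comp (hh.pow 2)).measurable
    _ = ENNReal.ofReal (a ^ 2) * ∫⁻ w, ENNReal.ofReal (h w ^ 2) := by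
        simp [mul_comm, mul_assoc, pow_two, ENNReal.ofReal_mul ha]

/-- Right translation by `(s, 0, 0)`, the flow of `X1`. -/
noncomputable def flowX1 (s : ℝ) (w : ℝ × ℝ × ℝ) : ℝ × ℝ × ℝ :=
  (w.1 + s, w.2.1, w.2.2 + s * (-w.2.1 / 2))

/-- Right translation by `(0, s, 0)`, the flow of `X2`. -/
noncomputable def flowX2 (s : ℝ) (w : ℝ × ℝ × ℝ) : ℝ × ℝ × ℝ :=
  (w.1, w.2.1 + s, w.2.2 + s * (w.1 / 2))

lemma continuous_flowX1 : Continuous (Function.uncurry flowX1) := by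
  unfold Function.uncurry flowX1
  fun_prop

lemma continuous_flowX2 : Continuous (Function.uncurry flowX2) := by
  unfold Function.uncurry flowX2
  fun_prop

lemma measurePreserving_flowX1 (s : ℝ) : MeasurePreserving (flowX1 s) volume volume := by
  have h : MeasurePreserving (fun v : ℝ × ℝ => (v.1, v.2 + s * (-v.1 / 2)))
      (volume.prod volume) (volume.prod volume) :=
    (MeasurePreserving.id volume).skew_product (g := fun x t => t + s * (-x / 2))
      (by fun_prop) (Filter.Eventually.of_forall fun x =>
        (measurePreserving_add_right volume (s * (-x / 2))).map_eq)
  exact (measurePreserving_add_right volume s).prod h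

lemma measurePreserving_flowX2 (s : ℝ) : MeasurePreserving (flowX2 s) volume volume := by
  have := isAddHaarMeasure_volume_real_prod_real
  exact (MeasurePreserving.id (volume : Measure ℝ)).skew_product
    (g := fun x (v : ℝ × ℝ) => v + (s, s * (x / 2)))
    (by fun_prop) (Filter.Eventually.of_forall fun x =>
      (measurePreserving_add_right (volume : Measure (ℝ × ℝ)) (s, s * (x / 2))).map_eq)

lemma hasDerivAt_comp_flowX1 {g : ℝ × ℝ × ℝ → ℝ} (hg : Differentiable ℝ g) (s : ℝ)
    (w : ℝ × ℝ × ℝ) : HasDerivAt (fun s => g (flowX1 s w)) (X1 g (flowX1 s w)) s := by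
  have h : HasDerivAt (fun s => flowX1 s w) (1, 0, -w.2.1 / 2) s := by
    refine ((hasDerivAt_id s).const_add w.1).prodMk ((hasDerivAt_const s w.2.1).prodMk ?_)
    simpa using ((hasDerivAt_id s).mul_const (-w.2.1 / 2)).const_add w.2.2
  exact (hg (flowX1 s w)).hasFDerivAt.comp_hasDerivAt s h

lemma hasDerivAt_comp_flowX2 {g : ℝ × ℝ × ℝ → ℝ} (hg : Differentiable ℝ g) (s : ℝ)
    (w : ℝ × ℝ × ℝ) : HasDerivAt (fun s => g (flowX2 s w)) (X2 g (flowX2 s w)) s := by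
  have h : HasDerivAt (fun s => flowX2 s w) (0, 1, w.1 / 2) s := by
    refine (hasDerivAt_const s w.1).prodMk (((hasDerivAt_id s).const_add w.2.1).prodMk ?_)
    simpa using ((hasDerivAt_id s).mul_const (w.1 / 2)).const_add w.2.2
  exact (hg (flowX2 s w)).hasFDerivAt.comp_hasDerivAt s h

lemma lintegral_sq_sub_flowX1_le {g : ℝ × ℝ × ℝ → ℝ} (hg : ContDiff ℝ 1 g) {a : ℝ} (ha : 0 ≤ a) :
    ∫⁻ w, ENNReal.ofReal ((g (flowX1 a w) - g w) ^ 2) ≤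
      ENNReal.ofReal (a ^ 2) * ∫⁻ w, ENNReal.ofReal (X1 g w ^ 2) :=
  lintegral_sq_sub_flow_le continuous_flowX1 measurePreserving_flowX1 (by simp [flowX1])
    (continuous_X1 hg) (hasDerivAt_comp_flowX1 (hg.differentiable one_ne_zero)) ha

lemma lintegral_sq_sub_flowX2_le {g : ℝ × ℝ × ℝ → ℝ} (hg : ContDiff ℝ 1 g) {a : ℝ} (ha : 0 ≤ a) :
    ∫⁻ w, ENNReal.ofReal ((g (flowX2 a w) - g w) ^ 2) ≤
      ENNReal.ofReal (a ^ 2) * ∫⁻ w, ENNReal.ofReal (X2 g w ^ 2) :=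
  lintegral_sq_sub_flow_le continuous_flowX2 measurePreserving_flowX2 (by simp [flowX2])
    (continuous_X2 hg) (hasDerivAt_comp_flowX2 (hg.differentiable one_ne_zero)) ha

end HorizontalFlows

section Nash

/-- The endpoint of a three-step horizontal path starting at `w`. -/
noncomputable def horizontalPath (y b a : ℝ) (w : ℝ × ℝ × ℝ) : ℝ × ℝ × ℝ :=
  flowX1 (y - a) (flowX2 b (flowX1 a w))

lemma horizontalPath_eq (y b a : ℝ) (w : ℝ × ℝ × ℝ) :
    horizontalPath y b a w = (w.1 + y, w.2.1 + b,
      (w.2.2 + b * w.1 / 2 - y * (w.2.1 + b) / 2) + b * a) := by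
  simp only [horizontalPath, flowX1, flowX2, Prod.mk.injEq]
  refine ⟨by ring, trivial, by ring⟩

lemma lintegral_sq_sub_horizontalPath_le {g : ℝ × ℝ × ℝ → ℝ} (hg : ContDiff ℝ 1 g)
    {y b a r : ℝ} (ha : a ∈ Set.Icc 0 r) (hb : b ∈ Set.Icc r (2 * r)) (hy : y ∈ Set.Icc r (2 * r)) :
    ∫⁻ w, ENNReal.ofReal ((g (horizontalPath y b a w) - g w) ^ 2) ≤
      ENNReal.ofReal (24 * r ^ 2) * ((∫⁻ w, ENNReal.ofReal (X1 g w ^ 2)) +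
        ∫⁻ w, ENNReal.ofReal (X2 g w ^ 2)) := by
  have hr : 0 ≤ r := ha.1.trans ha.2
  have hgc := hg.continuous
  have hF1 (s : ℝ) := lintegral_sq_sub_flowX1_le (a := s) hg
  have hF2 (s : ℝ) := lintegral_sq_sub_flowX2_le (a := s) hg
  set D1 := ∫⁻ w, ENNReal.ofReal (X1 g w ^ 2)
  set D2 := ∫⁻ w, ENNReal.ofReal (X2 g w ^ 2)
  have hm1 (s : ℝ) : Measurable fun w => ENNReal.ofReal ((g (flowX1 s w) - g w) ^ 2) := by
    have : Measurable (flowX1 s) := (measurePreserving_flowX1 s).measurable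
    have := hgc.measurable.comp this
    fun_prop
  have hm2 (s : ℝ) : Measurable fun w => ENNReal.ofReal ((g (flowX2 s w) - g w) ^ 2) := by
    have : Measurable (flowX2 s) := (measurePreserving_flowX2 s).measurable
    have := hgc.measurable.comp this
    fun_prop
  have mp1 := measurePreserving_flowX1 a
  have mp2 := measurePreserving_flowX2 b
  have hpt (w) : ENNReal.ofReal ((g (horizontalPath y b a w) - g w) ^ 2) ≤
      3 * (ENNReal.ofReal ((g (flowX1 (y - a) (flowX2 b (flowX1 a w))) -
          g (flowX2 b (flowX1 a w))) ^ 2) +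
        (ENNReal.ofReal ((g (flowX2 b (flowX1 a w)) - g (flowX1 a w)) ^ 2) +
        ENNReal.ofReal ((g (flowX1 a w) - g w) ^ 2))) := by
    rw [← ENNReal.ofReal_add (by positivity) (by positivity),
      ← ENNReal.ofReal_add (by positivity) (by positivity), ← ENNReal.ofReal_ofNat,
      ← ENNReal.ofReal_mul (by positivity)]
    refine ENNReal.ofReal_le_ofReal ?_
    rw [horizontalPath]
    generalize g (flowX1 (y - a) (flowX2 b (flowX1 a w))) = x₁
    generalize g (flowX2 b (flowX1 a w)) = x₂
    generalize g (flowX1 a w) = x₃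
    generalize g w = x₄
    nlinarith [sq_nonneg ((x₁ - x₂) - (x₂ - x₃)), sq_nonneg ((x₁ - x₂) - (x₃ - x₄)),
      sq_nonneg ((x₂ - x₃) - (x₃ - x₄))]
  have hle {s : ℝ} (h0 : 0 ≤ s) (h1 : s ≤ 2 * r) :
      ENNReal.ofReal (s ^ 2) ≤ ENNReal.ofReal (4 * r ^ 2) :=
    ENNReal.ofReal_le_ofReal (by nlinarith)
  calc ∫⁻ w, ENNReal.ofReal ((g (horizontalPath y b a w) - g w) ^ 2)
      ≤ _ := lintegral_mono hpt
    _ = 3 * ((∫⁻ w, ENNReal.ofReal ((g (flowX1 (y - a) w) - g w) ^ 2)) +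
        ((∫⁻ w, ENNReal.ofReal ((g (flowX2 b w) - g w) ^ 2)) +
        ∫⁻ w, ENNReal.ofReal ((g (flowX1 a w) - g w) ^ 2))) := by
      rw [lintegral_const_mul' _ _ (by simp), lintegral_add_right, lintegral_add_right]
      · rw [(mp2.comp mp1).lintegral_comp
          (f := fun w => ENNReal.ofReal ((g (flowX1 (y - a) w) - g w) ^ 2)) (hm1 _) |>.symm,
          mp1.lintegral_comp
          (f := fun w => ENNReal.ofReal ((g (flowX2 b w) - g w) ^ 2)) (hm2 _) |>.symm]
        rfl
      · exact hm1 a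
      · exact ((hm2 b).comp mp1.measurable).add (hm1 a)
    _ ≤ 3 * (ENNReal.ofReal (4 * r ^ 2) * D1 + (ENNReal.ofReal (4 * r ^ 2) * D2 +
        ENNReal.ofReal (4 * r ^ 2) * D1)) := by
      gcongr
      · exact (hF1 (y - a) (by linarith [hy.1, ha.2])).trans
          (mul_le_mul_left (hle (by linarith [hy.1, ha.2]) (by linarith [hy.2, ha.1])) _)
      · exact (hF2 b (by linarith [hb.1])).trans
          (mul_le_mul_left (hle (by linarith [hb.1]) (by linarith [hb.2])) _)
      · exact (hF1 a ha.1).trans (mul_le_mul_left (hle ha.1 (by linarith [ha.2])) _)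
    _ ≤ 3 * (2 * (ENNReal.ofReal (4 * r ^ 2) * (D1 + D2))) := by
      gcongr
      rw [two_mul, mul_add]
      generalize ENNReal.ofReal (4 * r ^ 2) * D1 = u
      generalize ENNReal.ofReal (4 * r ^ 2) * D2 = v
      calc u + (v + u) ≤ u + (v + u) + v := le_self_add
        _ = u + v + (u + v) := by ring
    _ = ENNReal.ofReal (24 * r ^ 2) * (D1 + D2) := by
      rw [show 24 * r ^ 2 = 3 * (2 * (4 * r ^ 2)) by ring, ENNReal.ofReal_mul (p := 3) (by norm_num),
        ENNReal.ofReal_mul (p := 2) (by norm_num), ENNReal.ofReal_ofNat, ENNReal.ofReal_ofNat]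
      ring

lemma lintegral_comp_add_mul_left {k : ℝ → ENNReal} (hk : Measurable k) (e : ℝ) {b : ℝ}
    (hb : 0 < b) : ∫⁻ a, k (e + b * a) = ENNReal.ofReal b⁻¹ * ∫⁻ a, k a := by
  have h1 : ∫⁻ a, k (e + b * a) = ∫⁻ a, k (e + a) ∂(Measure.map (b * ·) volume) := by
    rw [lintegral_map (by fun_prop) (by fun_prop)]
  rw [h1, Real.map_volume_mul_left hb.ne', lintegral_smul_measure,
    lintegral_add_left_eq_self k e, abs_of_pos (inv_pos.2 hb), smul_eq_mul]

lemma lintegral_horizontalPath_le {k : ℝ × ℝ × ℝ → ENNReal} (hk : Measurable k) {r : ℝ}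
    (hr : 0 < r) (w : ℝ × ℝ × ℝ) :
    ∫⁻ y in Set.Icc r (2 * r), ∫⁻ b in Set.Icc r (2 * r), ∫⁻ a in Set.Icc 0 r,
      k (horizontalPath y b a w) ≤ ENNReal.ofReal r⁻¹ * ∫⁻ v, k v := by
  have hm1 (x : ℝ) : Measurable fun v => k (x, v) := hk.comp (by fun_prop)
  have hm2 : Measurable fun q : ℝ × ℝ => ∫⁻ z, k (q.1, q.2, z) :=
    Measurable.lintegral_prod_right' (f := fun q : (ℝ × ℝ) × ℝ => k (q.1.1, q.1.2, q.2))
      (hk.comp (by fun_prop))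
  have hm3 : Measurable fun x : ℝ => ∫⁻ s, ∫⁻ z, k (x, s, z) := hm2.lintegral_prod_right'
  have hfub : ∫⁻ v, k v = ∫⁻ x, ∫⁻ s, ∫⁻ z, k (x, s, z) := by
    rw [Measure.volume_eq_prod, lintegral_prod _ hk.aemeasurable]
    refine lintegral_congr fun x => ?_
    rw [Measure.volume_eq_prod, lintegral_prod _ (hm1 x).aemeasurable]
  have inner (y b : ℝ) (hb : b ∈ Set.Icc r (2 * r)) :
      ∫⁻ a in Set.Icc 0 r, k (horizontalPath y b a w) ≤
        ENNReal.ofReal r⁻¹ * ∫⁻ z, k (w.1 + y, w.2.1 + b, z) := by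
    have hb0 : 0 < b := hr.trans_le hb.1
    refine (setLIntegral_le_lintegral _ _).trans ?_
    simp_rw [horizontalPath_eq]
    rw [lintegral_comp_add_mul_left (k := fun z => k (w.1 + y, w.2.1 + b, z))
      (hk.comp (by fun_prop)) _ hb0]
    gcongr
    exact hb.1
  calc _ ≤ ∫⁻ y in Set.Icc r (2 * r), ∫⁻ b in Set.Icc r (2 * r),
        ENNReal.ofReal r⁻¹ * ∫⁻ z, k (w.1 + y, w.2.1 + b, z) :=
        lintegral_mono fun y => setLIntegral_mono' measurableSet_Icc (inner y)
    _ ≤ ∫⁻ y, ∫⁻ b, ENNReal.ofReal r⁻¹ * ∫⁻ z, k (w.1 + y, w.2.1 + b, z) :=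
        (setLIntegral_le_lintegral _ _).trans
          (lintegral_mono fun y => setLIntegral_le_lintegral _ _)
    _ = ENNReal.ofReal r⁻¹ * ∫⁻ y, ∫⁻ b, ∫⁻ z, k (w.1 + y, w.2.1 + b, z) := by
        simp_rw [lintegral_const_mul' _ _ ENNReal.ofReal_ne_top]
    _ = ENNReal.ofReal r⁻¹ * ∫⁻ y, ∫⁻ b, ∫⁻ z, k (w.1 + y, b, z) := by
        congr 2
        ext y
        exact lintegral_add_left_eq_self (fun b => ∫⁻ z, k (w.1 + y, b, z)) w.2.1
    _ = ENNReal.ofReal r⁻¹ * ∫⁻ v, k v := by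
        rw [hfub]
        congr 1
        exact lintegral_add_left_eq_self (fun y => ∫⁻ b, ∫⁻ z, k (y, b, z)) w.1

/-- Nash-type inequality on the Heisenberg group for Lebesgue measure. -/
lemma lintegral_sq_le_nash {g : ℝ × ℝ × ℝ → ℝ} (hg : ContDiff ℝ 1 g) {r : ℝ} (hr : 0 < r) :
    ENNReal.ofReal (r ^ 3) * ∫⁻ w, ENNReal.ofReal (g w ^ 2) ≤
      ENNReal.ofReal (r ^ 3) * (ENNReal.ofReal (24 * r ^ 2) *
        ((∫⁻ w, ENNReal.ofReal (X1 g w ^ 2)) + ∫⁻ w, ENNReal.ofReal (X2 g w ^ 2))) +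
      2 * (ENNReal.ofReal r⁻¹ * (∫⁻ w, ENNReal.ofReal |g w|) ^ 2) := by
  have hgc := hg.continuous
  set D := (∫⁻ w, ENNReal.ofReal (X1 g w ^ 2)) + ∫⁻ w, ENNReal.ofReal (X2 g w ^ 2) with hD
  set k : ℝ × ℝ × ℝ → ENNReal := fun w => ENNReal.ofReal |g w| with hk
  have hkm : Measurable k := by fun_prop
  have hpathc : Continuous fun q : (ℝ × ℝ × ℝ) × ℝ × ℝ × ℝ =>
      horizontalPath q.1.1 q.1.2.1 q.1.2.2 q.2 := by
    simp_rw [horizontalPath_eq]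
    fun_prop
  have hjm : Measurable fun q : (ℝ × ℝ × ℝ) × ℝ × ℝ × ℝ =>
      k q.2 * k (horizontalPath q.1.1 q.1.2.1 q.1.2.2 q.2) :=
    (hkm.comp measurable_snd).mul (hkm.comp hpathc.measurable)
  set S : Set (ℝ × ℝ × ℝ) := Set.Icc r (2 * r) ×ˢ (Set.Icc r (2 * r) ×ˢ Set.Icc 0 r) with hS
  have hSm : MeasurableSet S := measurableSet_Icc.prod (measurableSet_Icc.prod measurableSet_Icc)
  have hvS : volume S = ENNReal.ofReal (r ^ 3) := by
    rw [hS, Measure.volume_eq_prod, Measure.prod_prod, Measure.volume_eq_prod, Measure.prod_prod]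
    simp only [Real.volume_Icc]
    rw [← ENNReal.ofReal_mul (by linarith), ← ENNReal.ofReal_mul (by linarith)]
    ring_nf
  have hfix (q : ℝ × ℝ × ℝ) (hq : q ∈ S) : ∫⁻ w, ENNReal.ofReal (g w ^ 2) ≤
      ENNReal.ofReal (24 * r ^ 2) * D +
        2 * ∫⁻ w, k w * k (horizontalPath q.1 q.2.1 q.2.2 w) := by
    have hpt (w) : ENNReal.ofReal (g w ^ 2) ≤
        ENNReal.ofReal ((g (horizontalPath q.1 q.2.1 q.2.2 w) - g w) ^ 2) +
          2 * (k w * k (horizontalPath q.1 q.2.1 q.2.2 w)) := by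
      rw [hk]
      dsimp only
      rw [← ENNReal.ofReal_mul (abs_nonneg _), ← ENNReal.ofReal_ofNat,
        ← ENNReal.ofReal_mul (by positivity), ← ENNReal.ofReal_add (by positivity) (by positivity)]
      refine ENNReal.ofReal_le_ofReal ?_
      rw [← abs_mul]
      nlinarith [le_abs_self (g w * g (horizontalPath q.1 q.2.1 q.2.2 w)),
        sq_nonneg (g (horizontalPath q.1 q.2.1 q.2.2 w))]
    refine (lintegral_mono hpt).trans ?_
    rw [lintegral_add_right, lintegral_const_mul' _ _ (by simp)]
    · gcongr
      exact lintegral_sq_sub_horizontalPath_le hg hq.2.2 hq.2.1 hq.1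
    · exact (hjm.comp (measurable_const.prodMk measurable_id)).const_mul 2
  have hcross : ∫⁻ q in S, ∫⁻ w, k w * k (horizontalPath q.1 q.2.1 q.2.2 w) ≤
      ENNReal.ofReal r⁻¹ * (∫⁻ w, k w) ^ 2 := by
    rw [lintegral_lintegral_swap (hjm.aemeasurable)]
    calc _ ≤ ∫⁻ w, k w * (ENNReal.ofReal r⁻¹ * ∫⁻ v, k v) := by
          refine lintegral_mono fun w => ?_
          have hm : Measurable fun q : ℝ × ℝ × ℝ => k (horizontalPath q.1 q.2.1 q.2.2 w) :=
            hkm.comp (hpathc.measurable.comp (measurable_id.prodMk measurable_const))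
          rw [lintegral_const_mul _ hm]
          gcongr
          refine le_trans (le_of_eq ?_) (lintegral_horizontalPath_le hkm hr w)
          rw [hS, Measure.volume_eq_prod, ← Measure.prod_restrict, lintegral_prod _ hm.aemeasurable]
          refine lintegral_congr fun y => ?_
          rw [Measure.volume_eq_prod, ← Measure.prod_restrict, lintegral_prod]
          exact (hm.comp (measurable_const.prodMk measurable_id)).aemeasurable
      _ = _ := by
          rw [lintegral_mul_const _ hkm]
          ring
  calc ENNReal.ofReal (r ^ 3) * ∫⁻ w, ENNReal.ofReal (g w ^ 2)
      = ∫⁻ _ in S, ∫⁻ w, ENNReal.ofReal (g w ^ 2) := by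
        rw [setLIntegral_const, hvS, mul_comm]
    _ ≤ ∫⁻ q in S, (ENNReal.ofReal (24 * r ^ 2) * D +
        2 * ∫⁻ w, k w * k (horizontalPath q.1 q.2.1 q.2.2 w)) := setLIntegral_mono' hSm hfix
    _ = ENNReal.ofReal (r ^ 3) * (ENNReal.ofReal (24 * r ^ 2) * D) +
        2 * ∫⁻ q in S, ∫⁻ w, k w * k (horizontalPath q.1 q.2.1 q.2.2 w) := by
        rw [lintegral_add_left measurable_const, setLIntegral_const, hvS,
          lintegral_const_mul' _ _ (by simp), mul_comm (ENNReal.ofReal (r ^ 3))]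
    _ ≤ _ := by gcongr

lemma integral_sq_le_nash {g : ℝ × ℝ × ℝ → ℝ} (hg : ContDiff ℝ 1 g) (hc : HasCompactSupport g)
    {r : ℝ} (hr : 0 < r) :
    ∫ w, g w ^ 2 ≤ 24 * r ^ 2 * (∫ w, (X1 g w ^ 2 + X2 g w ^ 2)) +
      2 / r ^ 4 * (∫ w, |g w|) ^ 2 := by
  have hgc := hg.continuous
  have key := lintegral_sq_le_nash hg hr
  have i0 : Integrable fun w => g w ^ 2 :=
    integrable_of_continuous_of_eq_zero (hgc.pow 2) hc fun w hw => by simp [hw]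
  have ia : Integrable fun w => |g w| :=
    integrable_of_continuous_of_eq_zero hgc.abs hc fun w hw => by simp [hw]
  have i1 : Integrable fun w => X1 g w ^ 2 :=
    integrable_of_continuous_of_eq_zero ((continuous_X1 hg).pow 2) (hasCompactSupport_X1 hc)
      fun w hw => by simp [hw]
  have i2 : Integrable fun w => X2 g w ^ 2 :=
    integrable_of_continuous_of_eq_zero ((continuous_X2 hg).pow 2) (hasCompactSupport_X2 hc)
      fun w hw => by simp [hw]
  have n0 : 0 ≤ ∫ w, g w ^ 2 := integral_nonneg fun w => sq_nonneg _
  have na : 0 ≤ ∫ w, |g w| := integral_nonneg fun w => abs_nonneg _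
  have n1 : 0 ≤ ∫ w, X1 g w ^ 2 := integral_nonneg fun w => sq_nonneg _
  have n2 : 0 ≤ ∫ w, X2 g w ^ 2 := integral_nonneg fun w => sq_nonneg _
  rw [← ofReal_integral_eq_lintegral_ofReal i0 (.of_forall fun w => sq_nonneg _),
    ← ofReal_integral_eq_lintegral_ofReal ia (.of_forall fun w => abs_nonneg _),
    ← ofReal_integral_eq_lintegral_ofReal i1 (.of_forall fun w => sq_nonneg _),
    ← ofReal_integral_eq_lintegral_ofReal i2 (.of_forall fun w => sq_nonneg _)] at key
  rw [integral_add i1 i2]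
  clear i0 ia i1 i2
  generalize ∫ w, g w ^ 2 = A at *
  generalize ∫ w, X1 g w ^ 2 = D₁ at *
  generalize ∫ w, X2 g w ^ 2 = D₂ at *
  generalize ∫ w, |g w| = L at *
  have h2 : (2 : ENNReal) = ENNReal.ofReal 2 := by simp
  rw [h2, ← ENNReal.ofReal_add n1 n2, ← ENNReal.ofReal_pow na,
    ← ENNReal.ofReal_mul (by positivity), ← ENNReal.ofReal_mul (by positivity),
    ← ENNReal.ofReal_mul (by positivity), ← ENNReal.ofReal_mul (by positivity),
    ← ENNReal.ofReal_mul (by positivity), ← ENNReal.ofReal_add (by positivity) (by positivity),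
    ENNReal.ofReal_le_ofReal_iff (by positivity)] at key
  refine le_of_mul_le_mul_left (key.trans (le_of_eq ?_)) (pow_pos hr 3)
  field_simp

end Nash

section KaplanPotential

/-- The fourth power of the Kaplan norm. -/
def kaplanPoly (w : ℝ × ℝ × ℝ) : ℝ := (w.1 ^ 2 + w.2.1 ^ 2) ^ 2 + 16 * w.2.2 ^ 2

/-- One quarter of `X1 kaplanPoly`. -/
def kaplanGrad1 (w : ℝ × ℝ × ℝ) : ℝ := (w.1 ^ 2 + w.2.1 ^ 2) * w.1 - 4 * w.2.2 * w.2.1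

/-- One quarter of `X2 kaplanPoly`. -/
def kaplanGrad2 (w : ℝ × ℝ × ℝ) : ℝ := (w.1 ^ 2 + w.2.1 ^ 2) * w.2.1 + 4 * w.2.2 * w.1

lemma kaplanPoly_nonneg (w : ℝ × ℝ × ℝ) : 0 ≤ kaplanPoly w := by
  unfold kaplanPoly
  positivity

lemma sq_le_kaplanPoly (w : ℝ × ℝ × ℝ) : (w.1 ^ 2 + w.2.1 ^ 2) ^ 2 ≤ kaplanPoly w := by
  unfold kaplanPoly
  nlinarith [sq_nonneg w.2.2]

lemma kaplanGrad_sq_add_sq (w : ℝ × ℝ × ℝ) :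
    kaplanGrad1 w ^ 2 + kaplanGrad2 w ^ 2 = (w.1 ^ 2 + w.2.1 ^ 2) * kaplanPoly w := by
  simp only [kaplanGrad1, kaplanGrad2, kaplanPoly]
  ring

lemma kaplanGrad_mul_add_mul (w : ℝ × ℝ × ℝ) :
    kaplanGrad1 w * w.1 + kaplanGrad2 w * w.2.1 = (w.1 ^ 2 + w.2.1 ^ 2) ^ 2 := by
  simp only [kaplanGrad1, kaplanGrad2]
  ring

lemma contDiff_kaplanPoly : ContDiff ℝ 1 kaplanPoly := by
  unfold kaplanPoly
  fun_prop

lemma contDiff_kaplanGrad1 : ContDiff ℝ 1 kaplanGrad1 := by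
  unfold kaplanGrad1
  fun_prop

lemma contDiff_kaplanGrad2 : ContDiff ℝ 1 kaplanGrad2 := by
  unfold kaplanGrad2
  fun_prop

lemma X1_fst (w : ℝ × ℝ × ℝ) : X1 (fun v => v.1) w = 1 := by
  have h : HasFDerivAt (fun v : ℝ × ℝ × ℝ => v.1) _ w := hasFDerivAt_fst (𝕜 := ℝ)
  simp [X1, h.fderiv]

lemma X2_snd_fst (w : ℝ × ℝ × ℝ) : X2 (fun v => v.2.1) w = 1 := by
  have h : HasFDerivAt (fun v : ℝ × ℝ × ℝ => v.2.1) _ w := (hasFDerivAt_snd (𝕜 := ℝ)).fst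
  simp [X2, h.fderiv]

lemma X1_kaplanPoly (w : ℝ × ℝ × ℝ) : X1 kaplanPoly w = 4 * kaplanGrad1 w := by
  have h1 : HasFDerivAt (fun v : ℝ × ℝ × ℝ => v.1) _ w := hasFDerivAt_fst (𝕜 := ℝ)
  have h2 : HasFDerivAt (fun v : ℝ × ℝ × ℝ => v.2.1) _ w := (hasFDerivAt_snd (𝕜 := ℝ)).fst
  have h3 : HasFDerivAt (fun v : ℝ × ℝ × ℝ => v.2.2) _ w := (hasFDerivAt_snd (𝕜 := ℝ)).snd
  have h : HasFDerivAt kaplanPoly _ w :=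
    (((h1.pow 2).add (h2.pow 2)).pow 2).add ((h3.pow 2).const_mul 16)
  simp [X1, h.fderiv, kaplanGrad1]
  ring

lemma X2_kaplanPoly (w : ℝ × ℝ × ℝ) : X2 kaplanPoly w = 4 * kaplanGrad2 w := by
  have h1 : HasFDerivAt (fun v : ℝ × ℝ × ℝ => v.1) _ w := hasFDerivAt_fst (𝕜 := ℝ)
  have h2 : HasFDerivAt (fun v : ℝ × ℝ × ℝ => v.2.1) _ w := (hasFDerivAt_snd (𝕜 := ℝ)).fst
  have h3 : HasFDerivAt (fun v : ℝ × ℝ × ℝ => v.2.2) _ w := (hasFDerivAt_snd (𝕜 := ℝ)).snd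
  have h : HasFDerivAt kaplanPoly _ w :=
    (((h1.pow 2).add (h2.pow 2)).pow 2).add ((h3.pow 2).const_mul 16)
  simp [X2, h.fderiv, kaplanGrad2]
  ring

lemma X1_kaplanGrad1_add_X2_kaplanGrad2 (w : ℝ × ℝ × ℝ) :
    X1 kaplanGrad1 w + X2 kaplanGrad2 w = 6 * (w.1 ^ 2 + w.2.1 ^ 2) := by
  have h1 : HasFDerivAt (fun v : ℝ × ℝ × ℝ => v.1) _ w := hasFDerivAt_fst (𝕜 := ℝ)
  have h2 : HasFDerivAt (fun v : ℝ × ℝ × ℝ => v.2.1) _ w := (hasFDerivAt_snd (𝕜 := ℝ)).fst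
  have h3 : HasFDerivAt (fun v : ℝ × ℝ × ℝ => v.2.2) _ w := (hasFDerivAt_snd (𝕜 := ℝ)).snd
  have hA1 : HasFDerivAt kaplanGrad1 _ w :=
    (((h1.pow 2).add (h2.pow 2)).mul h1).sub ((h3.const_mul 4).mul h2)
  have hA2 : HasFDerivAt kaplanGrad2 _ w :=
    (((h1.pow 2).add (h2.pow 2)).mul h2).add ((h3.const_mul 4).mul h1)
  simp [X1, X2, hA1.fderiv, hA2.fderiv]
  ring

lemma contDiff_kaplanPoly_rpow {h : ℝ} (hh : 1 / 2 < h) :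
    ContDiff ℝ 1 fun w => kaplanPoly w ^ h := by
  set z : ℝ × ℝ × ℝ → ℂ := fun w => (w.1 ^ 2 + w.2.1 ^ 2) • (1 : ℂ) + (4 * w.2.2) • Complex.I
  have hz : ContDiff ℝ 1 z := by fun_prop
  have key : (fun w => kaplanPoly w ^ h) = fun w => ‖z w‖ ^ (2 * h) := by
    ext w
    have : kaplanPoly w = ‖z w‖ ^ (2 : ℝ) := by
      rw [Real.rpow_two, Complex.sq_norm, Complex.normSq_apply]
      simp [z, kaplanPoly, Complex.smul_re, Complex.smul_im, -Complex.real_smul]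
      ring
    rw [this, ← Real.rpow_mul (norm_nonneg _)]
  rw [key]
  exact hz.norm_rpow (by linarith)

lemma fderiv_kaplanPoly_rpow_of_eq_zero {h : ℝ} (hh : 1 / 2 < h) {w : ℝ × ℝ × ℝ}
    (hw : kaplanPoly w = 0) : fderiv ℝ (fun v => kaplanPoly v ^ h) w = 0 := by
  refine IsLocalMin.fderiv_eq_zero (Filter.Eventually.of_forall fun v => ?_)
  simp only [hw, Real.zero_rpow (by linarith : h ≠ 0)]
  exact Real.rpow_nonneg (kaplanPoly_nonneg v) h

lemma X1_kaplanPoly_rpow {h : ℝ} (hh : 1 / 2 < h) (w : ℝ × ℝ × ℝ) :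
    X1 (fun v => kaplanPoly v ^ h) w = 4 * h * kaplanPoly w ^ (h - 1) * kaplanGrad1 w := by
  rcases (kaplanPoly_nonneg w).eq_or_lt with hw | hw
  · have hA : kaplanGrad1 w = 0 := by
      have := kaplanGrad_sq_add_sq w
      rw [← hw] at this
      nlinarith [sq_nonneg (kaplanGrad1 w), sq_nonneg (kaplanGrad2 w)]
    simp [X1, fderiv_kaplanPoly_rpow_of_eq_zero hh hw.symm, hA]
  · rw [X1_comp (φ := fun x => x ^ h) (Real.hasDerivAt_rpow_const (Or.inl hw.ne'))
      (contDiff_kaplanPoly.differentiable one_ne_zero w), X1_kaplanPoly]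
    ring

lemma X2_kaplanPoly_rpow {h : ℝ} (hh : 1 / 2 < h) (w : ℝ × ℝ × ℝ) :
    X2 (fun v => kaplanPoly v ^ h) w = 4 * h * kaplanPoly w ^ (h - 1) * kaplanGrad2 w := by
  rcases (kaplanPoly_nonneg w).eq_or_lt with hw | hw
  · have hA : kaplanGrad2 w = 0 := by
      have := kaplanGrad_sq_add_sq w
      rw [← hw] at this
      nlinarith [sq_nonneg (kaplanGrad1 w), sq_nonneg (kaplanGrad2 w)]
    simp [X2, fderiv_kaplanPoly_rpow_of_eq_zero hh hw.symm, hA]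
  · rw [X2_comp (φ := fun x => x ^ h) (Real.hasDerivAt_rpow_const (Or.inl hw.ne'))
      (contDiff_kaplanPoly.differentiable one_ne_zero w), X2_kaplanPoly]
    ring

/-- The unnormalised density `exp (-N ^ (4 * h))`. -/
noncomputable def kaplanDensity (h : ℝ) (w : ℝ × ℝ × ℝ) : ℝ := Real.exp (-kaplanPoly w ^ h)

lemma kaplanDensity_pos (h : ℝ) (w : ℝ × ℝ × ℝ) : 0 < kaplanDensity h w := Real.exp_pos _

lemma contDiff_kaplanDensity {h : ℝ} (hh : 1 / 2 < h) : ContDiff ℝ 1 (kaplanDensity h) :=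
  (contDiff_kaplanPoly_rpow hh).neg.exp

lemma X1_kaplanDensity {h : ℝ} (hh : 1 / 2 < h) (w : ℝ × ℝ × ℝ) :
    X1 (kaplanDensity h) w =
      -(4 * h * kaplanPoly w ^ (h - 1) * kaplanGrad1 w) * kaplanDensity h w := by
  have hd := (hasDerivAt_neg (kaplanPoly w ^ h)).exp
  have := X1_comp (φ := fun x => Real.exp (-x)) (F := fun v => kaplanPoly v ^ h) hd
    ((contDiff_kaplanPoly_rpow hh).differentiable one_ne_zero w)
  rw [X1_kaplanPoly_rpow hh] at this
  refine (show X1 (kaplanDensity h) w = _ from this).trans ?_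
  simp only [kaplanDensity]
  ring

lemma X2_kaplanDensity {h : ℝ} (hh : 1 / 2 < h) (w : ℝ × ℝ × ℝ) :
    X2 (kaplanDensity h) w =
      -(4 * h * kaplanPoly w ^ (h - 1) * kaplanGrad2 w) * kaplanDensity h w := by
  have hd := (hasDerivAt_neg (kaplanPoly w ^ h)).exp
  have := X2_comp (φ := fun x => Real.exp (-x)) (F := fun v => kaplanPoly v ^ h) hd
    ((contDiff_kaplanPoly_rpow hh).differentiable one_ne_zero w)
  rw [X2_kaplanPoly_rpow hh] at this
  refine (show X2 (kaplanDensity h) w = _ from this).trans ?_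
  simp only [kaplanDensity]
  ring

end KaplanPotential

section PointwiseBounds

lemma rpow_add_le_mul {h P : ℝ} (hh : 1 / 2 < h) (hP : 1 ≤ P) :
    (1 + P) ^ h ≤ 2 ^ h * P ^ h := by
  rw [← Real.mul_rpow (by norm_num) (by linarith)]
  exact Real.rpow_le_rpow (by linarith) (by linarith) (by linarith)

/-- The pointwise inequality `Y · ∇V - div Y - s |Y|² ≥ (1 + P) ^ (h - 1 / 2) / 2 - C` for the
field `Y` given by `uField1` and `uField2` below, with `R = x₁ ^ 2 + x₂ ^ 2`. -/
lemma exists_weight_bound {h : ℝ} (hh : 1 / 2 < h) :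
    ∃ s > 0, ∃ C ≥ 0, ∀ P R : ℝ, 0 ≤ P → 0 ≤ R → R ^ 2 ≤ P →
      (1 + P) ^ (h - 1 / 2) / 2 - C ≤
        4 * h * P ^ (h - 1) * ((1 + P) ^ (h - 1) * (R * P)
            - 1 / 4 * (1 + P) ^ (h - 1 / 2) * R ^ 2)
          - (6 * R * (1 + P) ^ (h - 1) + 4 * (h - 1) * (1 + P) ^ (h - 2) * (R * P)
            - 1 / 2 * (1 + P) ^ (h - 1 / 2) - (h - 1 / 2) * (1 + P) ^ (h - 3 / 2) * R ^ 2)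
          - s * (2 * (1 + P) ^ (2 * h - 1) * R) := by
  set s : ℝ := h / (2 * 2 ^ h) with hs
  have hspos : 0 < s := by positivity
  set T : ℝ := 257 ^ h with hT
  have hT0 : 0 < T := by positivity
  refine ⟨s, hspos, 17 * h * T * T + 16 * (6 + 4 * h) * T + 32 * s * (T * T), by positivity, ?_⟩
  intro P R hP hR hRP
  have hm : (0 : ℝ) < 1 + P := by linarith
  set a := (1 + P) ^ (h - 1) with ha
  set c := (1 + P) ^ h with hc
  set b := P ^ h with hb
  set n := Real.sqrt (1 + P) with hn
  have ha0 : 0 < a := by positivity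
  have hc0 : 0 < c := by positivity
  have hb0 : 0 ≤ b := by positivity
  have hn0 : 0 < n := Real.sqrt_pos.2 hm
  have hn2 : n ^ 2 = 1 + P := Real.sq_sqrt hm.le
  have e1 : (1 + P) ^ (h - 1 / 2) = a * n := by
    rw [ha, hn, Real.sqrt_eq_rpow, ← Real.rpow_add hm]; ring_nf
  have e2 : (1 + P) ^ (2 * h - 1) = c * a := by
    rw [ha, hc, ← Real.rpow_add hm]; ring_nf
  have e3 : (1 + P) ^ (h - 2) * P ≤ a := by
    have : (1 + P) ^ (h - 2) * (1 + P) = a := by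
      rw [ha]; nth_rw 2 [← Real.rpow_one (1 + P)]; rw [← Real.rpow_add hm]; ring_nf
    nlinarith [Real.rpow_pos_of_pos hm (h - 2)]
  have e3' : 0 ≤ (1 + P) ^ (h - 2) * P := by positivity
  have e4 : P ^ (h - 1) * P = b := by
    rcases hP.eq_or_lt with h0 | h0
    · rw [hb, ← h0, Real.zero_rpow (by linarith : h ≠ 0), mul_zero]
    · rw [hb]; nth_rw 2 [← Real.rpow_one P]; rw [← Real.rpow_add h0]; ring_nf
  have e5 : 0 ≤ (h - 1 / 2) * (1 + P) ^ (h - 3 / 2) * R ^ 2 :=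
    mul_nonneg (mul_nonneg (by linarith) (Real.rpow_nonneg hm.le _)) (sq_nonneg R)
  have e6 : (h - 1) * ((1 + P) ^ (h - 2) * P) ≤ h * a := by nlinarith
  rw [e1, e2]
  have main : 0 ≤ 17 * h * T * T + 16 * (6 + 4 * h) * T + 32 * s * (T * T) +
      R * (4 * h * b * a - h * P ^ (h - 1) * R * a * n - (6 + 4 * h) * a - 2 * s * (c * a)) := by
    have hac : a ≤ c := Real.rpow_le_rpow_of_exponent_le (by linarith) (by linarith)
    have hbc : b ≤ c := Real.rpow_le_rpow hP (by linarith) (by linarith)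
    have hP1 : 0 ≤ P ^ (h - 1) := Real.rpow_nonneg hP _
    by_cases hsmall : P < 256
    · have hR16 : R ≤ 16 := by nlinarith
      have hcT : c ≤ T := Real.rpow_le_rpow hm.le (by linarith) (by linarith)
      have hn17 : n ≤ 17 := by nlinarith
      have t1 : P ^ (h - 1) * R * R ≤ T := by
        calc P ^ (h - 1) * R * R = P ^ (h - 1) * R ^ 2 := by ring
          _ ≤ P ^ (h - 1) * P := by gcongr
          _ ≤ T := e4.trans_le (hbc.trans hcT)
      have t2 : R * (h * P ^ (h - 1) * R * a * n) ≤ 17 * h * T * T := by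
        calc R * (h * P ^ (h - 1) * R * a * n) = h * (P ^ (h - 1) * R * R) * a * n := by ring
          _ ≤ h * T * T * 17 := by gcongr; exact hac.trans hcT
          _ = _ := by ring
      have t3 : R * ((6 + 4 * h) * a) ≤ 16 * ((6 + 4 * h) * T) := by
        gcongr; exact hac.trans hcT
      have t4 : R * (2 * s * (c * a)) ≤ 16 * (2 * s * (T * T)) := by
        gcongr; exact hac.trans hcT
      have t5 : 0 ≤ R * (4 * h * b * a) := by positivity
      linarith
    · push Not at hsmall
      have hPpos : 0 < P := by linarith
      have hsq : Real.sqrt P ^ 2 = P := Real.sq_sqrt hP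
      have hq16 : 16 ≤ Real.sqrt P := Real.le_sqrt_of_sq_le (by linarith)
      have hb16 : 16 ≤ b := hq16.trans <| by
        rw [Real.sqrt_eq_rpow]
        exact Real.rpow_le_rpow_of_exponent_le (by linarith) hh.le
      have hnq : n ≤ 3 / 2 * Real.sqrt P := by
        refine abs_le_of_sq_le_sq' ?_ (by positivity) |>.2
        nlinarith
      have hRq : R ≤ Real.sqrt P := Real.le_sqrt_of_sq_le hRP
      have hRn : R * n ≤ 3 / 2 * P := by
        calc R * n ≤ Real.sqrt P * (3 / 2 * Real.sqrt P) := by gcongr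
          _ = 3 / 2 * Real.sqrt P ^ 2 := by ring
          _ = 3 / 2 * P := by rw [hsq]
      have t1 : P ^ (h - 1) * (R * n) ≤ 3 / 2 * b := by
        rw [← e4]
        linarith [mul_le_mul_of_nonneg_left hRn hP1]
      have t2 : 2 * s * c ≤ h * b := by
        have hc2 : c ≤ 2 ^ h * b := rpow_add_le_mul hh (by linarith)
        calc 2 * s * c ≤ 2 * s * (2 ^ h * b) := by gcongr
          _ = h * b := by rw [hs]; field_simp
      have t3 : 0 ≤ 4 * h * b - h * (P ^ (h - 1) * (R * n)) - (6 + 4 * h) - 2 * s * c := by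
        have t1' := mul_le_mul_of_nonneg_left t1 (by linarith : 0 ≤ h)
        have hb' := mul_le_mul_of_nonneg_left hb16 (by linarith : 0 ≤ h)
        linarith
      have t4 := mul_nonneg hR (mul_nonneg ha0.le t3)
      have : 0 ≤ 17 * h * T * T + 16 * (6 + 4 * h) * T + 32 * s * (T * T) := by positivity
      linarith
  have e6R := mul_le_mul_of_nonneg_left e6 hR
  have e4' : 4 * h * P ^ (h - 1) * (a * (R * P)) = R * (4 * h * b * a) := by
    rw [← e4]; ring
  linarith

/-- Boundedness of `|∇V|² e^{-V}` for `V = P ^ h`. -/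
lemma rpow_mul_exp_neg_rpow_le {h P R : ℝ} (hh : 1 / 2 < h) (hP : 0 ≤ P) (hR : 0 ≤ R)
    (hRP : R ^ 2 ≤ P) :
    (4 * h * P ^ (h - 1)) ^ 2 * (R * P) * Real.exp (-P ^ h) ≤ 48 * h ^ 2 := by
  set b := P ^ h with hb
  have hb0 : 0 ≤ b := by positivity
  have key : (P ^ (h - 1)) ^ 2 * (R * P) ≤ 1 + b ^ 2 := by
    rcases hP.eq_or_lt with h0 | h0
    · rw [← h0]; nlinarith
    have e4 : P ^ (h - 1) * P = b := by
      rw [hb]; nth_rw 2 [← Real.rpow_one P]; rw [← Real.rpow_add h0]; ring_nf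
    have hRq : R ≤ Real.sqrt P := Real.le_sqrt_of_sq_le hRP
    rcases le_total P 1 with h1 | h1
    · have : (P ^ (h - 1)) ^ 2 * (Real.sqrt P * P) ≤ 1 := by
        rw [Real.sqrt_eq_rpow, ← Real.rpow_natCast, ← Real.rpow_mul hP]
        nth_rw 3 [← Real.rpow_one P]
        rw [← Real.rpow_add h0, ← Real.rpow_add h0]
        exact Real.rpow_le_one hP h1 (by push_cast; linarith)
      calc (P ^ (h - 1)) ^ 2 * (R * P) ≤ (P ^ (h - 1)) ^ 2 * (Real.sqrt P * P) := by gcongr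
        _ ≤ 1 + b ^ 2 := by nlinarith
    · have hRP' : R ≤ P := by nlinarith
      calc (P ^ (h - 1)) ^ 2 * (R * P) ≤ (P ^ (h - 1)) ^ 2 * (P * P) := by gcongr
        _ = b ^ 2 := by rw [← e4]; ring
        _ ≤ 1 + b ^ 2 := by linarith
  have hexp : (1 + b ^ 2) * Real.exp (-b) ≤ 3 := by
    rw [Real.exp_neg, ← div_eq_mul_inv, div_le_iff₀ (Real.exp_pos b)]
    have := Real.quadratic_le_exp_of_nonneg hb0
    nlinarith
  calc (4 * h * P ^ (h - 1)) ^ 2 * (R * P) * Real.exp (-b)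
      = 16 * h ^ 2 * ((P ^ (h - 1)) ^ 2 * (R * P) * Real.exp (-b)) := by ring
    _ ≤ 16 * h ^ 2 * ((1 + b ^ 2) * Real.exp (-b)) := by gcongr
    _ ≤ 16 * h ^ 2 * 3 := by gcongr
    _ = 48 * h ^ 2 := by ring

/-- Splitting according to whether the weight `(1 + P) ^ (h - 1 / 2)` exceeds `M`. -/
lemma exp_neg_rpow_le {h P M : ℝ} (hh : 1 / 2 < h) (hP : 0 ≤ P) (hM : 0 < M) :
    Real.exp (-P ^ h) ≤ (1 + P) ^ (h - 1 / 2) * Real.exp (-P ^ h) / M +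
      Real.exp (M ^ (h / (h - 1 / 2))) * Real.exp (-P ^ h) ^ 2 := by
  have hm : (0 : ℝ) < 1 + P := by linarith
  set y := (1 + P) ^ (h - 1 / 2) with hy
  have hy0 : 0 < y := by positivity
  have hE := Real.exp_pos (-P ^ h)
  rcases le_total M y with hMy | hMy
  · have : Real.exp (-P ^ h) ≤ y * Real.exp (-P ^ h) / M := by
      rw [le_div_iff₀ hM]; nlinarith
    have : 0 ≤ Real.exp (M ^ (h / (h - 1 / 2))) * Real.exp (-P ^ h) ^ 2 := by positivity
    linarith
  · have h1 : P ^ h ≤ M ^ (h / (h - 1 / 2)) := by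
      calc P ^ h ≤ (1 + P) ^ h := Real.rpow_le_rpow hP (by linarith) (by linarith)
        _ = y ^ (h / (h - 1 / 2)) := by
          rw [hy, ← Real.rpow_mul hm.le, mul_div_cancel₀ _ (by linarith)]
        _ ≤ _ := Real.rpow_le_rpow hy0.le hMy (div_nonneg (by linarith) (by linarith))
    have h2 : 1 ≤ Real.exp (M ^ (h / (h - 1 / 2))) * Real.exp (-P ^ h) := by
      rw [← Real.exp_add]; exact Real.one_le_exp (by linarith)
    have : 0 ≤ y * Real.exp (-P ^ h) / M := by positivity
    nlinarith

end PointwiseBounds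

section UBound

/-- First component of the horizontal field used to derive the U-bound. -/
noncomputable def uField1 (h : ℝ) (w : ℝ × ℝ × ℝ) : ℝ :=
  (1 + kaplanPoly w) ^ (h - 1) * kaplanGrad1 w - 1 / 4 * (1 + kaplanPoly w) ^ (h - 1 / 2) * w.1

/-- Second component of the horizontal field used to derive the U-bound. -/
noncomputable def uField2 (h : ℝ) (w : ℝ × ℝ × ℝ) : ℝ :=
  (1 + kaplanPoly w) ^ (h - 1) * kaplanGrad2 w - 1 / 4 * (1 + kaplanPoly w) ^ (h - 1 / 2) * w.2.1

lemma one_add_kaplanPoly_pos (w : ℝ × ℝ × ℝ) : 0 < 1 + kaplanPoly w := by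
  linarith [kaplanPoly_nonneg w]

lemma contDiff_one_add_kaplanPoly_rpow (q : ℝ) :
    ContDiff ℝ 1 fun w => (1 + kaplanPoly w) ^ q :=
  (contDiff_const.add contDiff_kaplanPoly).rpow_const_of_ne
    fun w => (one_add_kaplanPoly_pos w).ne'

lemma contDiff_uField1 (h : ℝ) : ContDiff ℝ 1 (uField1 h) :=
  ((contDiff_one_add_kaplanPoly_rpow _).mul contDiff_kaplanGrad1).sub
    ((contDiff_const.mul (contDiff_one_add_kaplanPoly_rpow _)).mul contDiff_fst)

lemma contDiff_uField2 (h : ℝ) : ContDiff ℝ 1 (uField2 h) :=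
  ((contDiff_one_add_kaplanPoly_rpow _).mul contDiff_kaplanGrad2).sub
    ((contDiff_const.mul (contDiff_one_add_kaplanPoly_rpow _)).mul contDiff_snd.fst)

lemma X1_one_add_kaplanPoly_rpow (q : ℝ) (w : ℝ × ℝ × ℝ) :
    X1 (fun v => (1 + kaplanPoly v) ^ q) w =
      4 * q * (1 + kaplanPoly w) ^ (q - 1) * kaplanGrad1 w := by
  have hd : HasDerivAt (fun x : ℝ => (1 + x) ^ q) (1 * q * (1 + kaplanPoly w) ^ (q - 1))
      (kaplanPoly w) :=
    ((hasDerivAt_id (kaplanPoly w)).const_add 1).rpow_const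
      (Or.inl (one_add_kaplanPoly_pos w).ne')
  rw [X1_comp (φ := fun x => (1 + x) ^ q) hd
    (contDiff_kaplanPoly.differentiable one_ne_zero w), X1_kaplanPoly]
  ring

lemma X2_one_add_kaplanPoly_rpow (q : ℝ) (w : ℝ × ℝ × ℝ) :
    X2 (fun v => (1 + kaplanPoly v) ^ q) w =
      4 * q * (1 + kaplanPoly w) ^ (q - 1) * kaplanGrad2 w := by
  have hd : HasDerivAt (fun x : ℝ => (1 + x) ^ q) (1 * q * (1 + kaplanPoly w) ^ (q - 1))
      (kaplanPoly w) :=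
    ((hasDerivAt_id (kaplanPoly w)).const_add 1).rpow_const
      (Or.inl (one_add_kaplanPoly_pos w).ne')
  rw [X2_comp (φ := fun x => (1 + x) ^ q) hd
    (contDiff_kaplanPoly.differentiable one_ne_zero w), X2_kaplanPoly]
  ring

lemma X1_uField1_add_X2_uField2 (h : ℝ) (w : ℝ × ℝ × ℝ) :
    X1 (uField1 h) w + X2 (uField2 h) w =
      6 * (w.1 ^ 2 + w.2.1 ^ 2) * (1 + kaplanPoly w) ^ (h - 1)
        + 4 * (h - 1) * (1 + kaplanPoly w) ^ (h - 2) * ((w.1 ^ 2 + w.2.1 ^ 2) * kaplanPoly w)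
        - 1 / 2 * (1 + kaplanPoly w) ^ (h - 1 / 2)
        - (h - 1 / 2) * (1 + kaplanPoly w) ^ (h - 3 / 2) * (w.1 ^ 2 + w.2.1 ^ 2) ^ 2 := by
  have dm (q : ℝ) := (contDiff_one_add_kaplanPoly_rpow q).differentiable one_ne_zero w
  have dA1 := contDiff_kaplanGrad1.differentiable one_ne_zero w
  have dA2 := contDiff_kaplanGrad2.differentiable one_ne_zero w
  have dx : DifferentiableAt ℝ (fun v : ℝ × ℝ × ℝ => v.1) w := by fun_prop
  have dy : DifferentiableAt ℝ (fun v : ℝ × ℝ × ℝ => v.2.1) w := by fun_prop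
  have dx' : DifferentiableAt ℝ (fun v : ℝ × ℝ × ℝ => 1 / 4 * v.1) w := by fun_prop
  have dy' : DifferentiableAt ℝ (fun v : ℝ × ℝ × ℝ => 1 / 4 * v.2.1) w := by fun_prop
  have hx : X1 (fun v => 1 / 4 * v.1) w = 1 / 4 := by
    rw [X1_comp (φ := fun x => 1 / 4 * x) ((hasDerivAt_id w.1).const_mul (1 / 4)) dx, X1_fst]
    norm_num
  have hy : X2 (fun v => 1 / 4 * v.2.1) w = 1 / 4 := by
    rw [X2_comp (φ := fun x => 1 / 4 * x) ((hasDerivAt_id w.2.1).const_mul (1 / 4)) dy,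
      X2_snd_fst]
    norm_num
  have e1 : uField1 h = fun v => (1 + kaplanPoly v) ^ (h - 1) * kaplanGrad1 v
      - (1 + kaplanPoly v) ^ (h - 1 / 2) * (1 / 4 * v.1) := by
    ext v; simp only [uField1]; ring
  have e2 : uField2 h = fun v => (1 + kaplanPoly v) ^ (h - 1) * kaplanGrad2 v
      - (1 + kaplanPoly v) ^ (h - 1 / 2) * (1 / 4 * v.2.1) := by
    ext v; simp only [uField2]; ring
  rw [e1, e2, X1_sub ((dm _).fun_mul dA1) ((dm _).fun_mul dx'),
    X2_sub ((dm _).fun_mul dA2) ((dm _).fun_mul dy'),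
    X1_mul (dm _) dA1, X2_mul (dm _) dA2, X1_mul (dm _) dx', X2_mul (dm _) dy', hx, hy]
  simp only [X1_one_add_kaplanPoly_rpow, X2_one_add_kaplanPoly_rpow]
  have r1 : h - 1 - 1 = h - 2 := by ring
  have r2 : h - 1 / 2 - 1 = h - 3 / 2 := by ring
  rw [r1, r2]
  have i1 := X1_kaplanGrad1_add_X2_kaplanGrad2 w
  have i2 := kaplanGrad_sq_add_sq w
  have i3 := kaplanGrad_mul_add_mul w
  linear_combination (1 + kaplanPoly w) ^ (h - 1) * i1
    + 4 * (h - 1) * (1 + kaplanPoly w) ^ (h - 2) * i2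
    - (h - 1 / 2) * (1 + kaplanPoly w) ^ (h - 3 / 2) * i3

lemma uField_sq_add_sq_le (h : ℝ) (w : ℝ × ℝ × ℝ) :
    uField1 h w ^ 2 + uField2 h w ^ 2 ≤
      2 * (1 + kaplanPoly w) ^ (2 * h - 1) * (w.1 ^ 2 + w.2.1 ^ 2) := by
  have hm := one_add_kaplanPoly_pos w
  have hP := kaplanPoly_nonneg w
  set R := w.1 ^ 2 + w.2.1 ^ 2 with hR
  have hR0 : 0 ≤ R := by positivity
  set m := 1 + kaplanPoly w with hmdef
  have e : uField1 h w ^ 2 + uField2 h w ^ 2 = (m ^ (h - 1)) ^ 2 * (R * kaplanPoly w)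
      - 1 / 2 * (m ^ (h - 1) * m ^ (h - 1 / 2)) * R ^ 2
      + 1 / 16 * (m ^ (h - 1 / 2)) ^ 2 * R := by
    simp only [uField1, uField2, ← hmdef]
    have i2 := kaplanGrad_sq_add_sq w
    have i3 := kaplanGrad_mul_add_mul w
    rw [← hR] at i2 i3
    rw [hR] at i2 i3 ⊢
    linear_combination (m ^ (h - 1)) ^ 2 * i2 - 1 / 2 * (m ^ (h - 1) * m ^ (h - 1 / 2)) * i3
  have e1 : (m ^ (h - 1)) ^ 2 * m = m ^ (2 * h - 1) := by
    rw [← Real.rpow_natCast, ← Real.rpow_mul hm.le]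
    nth_rw 2 [← Real.rpow_one m]
    rw [← Real.rpow_add hm]; congr 1; push_cast; ring
  have e2 : (m ^ (h - 1 / 2)) ^ 2 = m ^ (2 * h - 1) := by
    rw [← Real.rpow_natCast, ← Real.rpow_mul hm.le]; congr 1; push_cast; ring
  have t1 : (m ^ (h - 1)) ^ 2 * (R * kaplanPoly w) ≤ m ^ (2 * h - 1) * R := by
    rw [← e1]
    have : (m ^ (h - 1)) ^ 2 * (R * kaplanPoly w) ≤ (m ^ (h - 1)) ^ 2 * (R * m) := by
      gcongr; linarith
    linarith
  have t2 : 0 ≤ 1 / 2 * (m ^ (h - 1) * m ^ (h - 1 / 2)) * R ^ 2 := by positivity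
  have t3 : 0 ≤ m ^ (2 * h - 1) * R := by positivity
  rw [e, e2]
  linarith

/-- The U-bound `∫ f² N^(p-2) dμ ≲ ∫ |∇f|² dμ + ∫ f² dμ`. -/
lemma exists_uBound {h : ℝ} (hh : 1 / 2 < h) :
    ∃ C₁ > 0, ∃ C₂ > 0, ∀ f : ℝ × ℝ × ℝ → ℝ, ContDiff ℝ 1 f → HasCompactSupport f →
      ∫ w, f w ^ 2 * ((1 + kaplanPoly w) ^ (h - 1 / 2) * kaplanDensity h w) ≤
        C₁ * (∫ w, (X1 f w ^ 2 + X2 f w ^ 2) * kaplanDensity h w) +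
          C₂ * ∫ w, f w ^ 2 * kaplanDensity h w := by
  obtain ⟨s, hs, C, hC, key⟩ := exists_weight_bound hh
  refine ⟨2 / s, by positivity, 2 * C + 1, by positivity, fun f hf hc => ?_⟩
  have hρ := contDiff_kaplanDensity hh
  have hρc := hρ.continuous
  have hfc := hf.continuous
  have hF1 : ContDiff ℝ 1 fun w => f w ^ 2 * (kaplanDensity h w * uField1 h w) :=
    (hf.pow 2).mul (hρ.mul (contDiff_uField1 h))
  have hF2 : ContDiff ℝ 1 fun w => f w ^ 2 * (kaplanDensity h w * uField2 h w) :=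
    (hf.pow 2).mul (hρ.mul (contDiff_uField2 h))
  have hc1 : HasCompactSupport fun w => f w ^ 2 * (kaplanDensity h w * uField1 h w) :=
    hc.mono fun w hw h0 => hw (by simp [h0])
  have hc2 : HasCompactSupport fun w => f w ^ 2 * (kaplanDensity h w * uField2 h w) :=
    hc.mono fun w hw h0 => hw (by simp [h0])
  have I1 := integral_X1_eq_zero hF1 hc1
  have I2 := integral_X2_eq_zero hF2 hc2
  have int1 := (continuous_X1 hF1).integrable_of_hasCompactSupport (hasCompactSupport_X1 hc1)
    (μ := volume)
  have int2 := (continuous_X2 hF2).integrable_of_hasCompactSupport (hasCompactSupport_X2 hc2)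
    (μ := volume)
  have hψc := (contDiff_one_add_kaplanPoly_rpow (h - 1 / 2)).continuous
  have intψ : Integrable fun w =>
      f w ^ 2 * ((1 + kaplanPoly w) ^ (h - 1 / 2) * kaplanDensity h w) :=
    integrable_of_continuous_of_eq_zero (by fun_prop) hc fun w hw => by simp [hw]
  have intA : Integrable fun w => f w ^ 2 * kaplanDensity h w :=
    integrable_of_continuous_of_eq_zero (by fun_prop) hc fun w hw => by simp [hw]
  have hX1c := continuous_X1 hf
  have hX2c := continuous_X2 hf
  have intE1 : Integrable fun w => X1 f w ^ 2 * kaplanDensity h w :=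
    integrable_of_continuous_of_eq_zero (by fun_prop) (hasCompactSupport_X1 hc)
      fun w hw => by simp [hw]
  have intE2 : Integrable fun w => X2 f w ^ 2 * kaplanDensity h w :=
    integrable_of_continuous_of_eq_zero (by fun_prop) (hasCompactSupport_X2 hc)
      fun w hw => by simp [hw]
  have intE : Integrable fun w => (X1 f w ^ 2 + X2 f w ^ 2) * kaplanDensity h w := by
    simpa only [add_mul] using intE1.fun_add intE2
  have pointwise (w : ℝ × ℝ × ℝ) :
      f w ^ 2 * ((1 + kaplanPoly w) ^ (h - 1 / 2) * kaplanDensity h w) ≤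
        2 / s * ((X1 f w ^ 2 + X2 f w ^ 2) * kaplanDensity h w)
          + 2 * C * (f w ^ 2 * kaplanDensity h w)
          - 2 * (X1 (fun w => f w ^ 2 * (kaplanDensity h w * uField1 h w)) w
            + X2 (fun w => f w ^ 2 * (kaplanDensity h w * uField2 h w)) w) := by
    have df := hf.differentiable one_ne_zero w
    have df2 : DifferentiableAt ℝ (fun v => f v ^ 2) w := df.pow 2
    have dρ := hρ.differentiable one_ne_zero w
    have dY1 := (contDiff_uField1 h).differentiable one_ne_zero w
    have dY2 := (contDiff_uField2 h).differentiable one_ne_zero w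
    have hf2 : HasDerivAt (fun x : ℝ => x ^ 2) (2 * f w) (f w) := by
      simpa using hasDerivAt_pow 2 (f w)
    rw [X1_mul df2 (dρ.fun_mul dY1), X2_mul df2 (dρ.fun_mul dY2), X1_mul dρ dY1, X2_mul dρ dY2,
      X1_kaplanDensity hh, X2_kaplanDensity hh, X1_comp hf2 df, X2_comp hf2 df]
    have k := key (kaplanPoly w) (w.1 ^ 2 + w.2.1 ^ 2) (kaplanPoly_nonneg w) (by positivity)
      (sq_le_kaplanPoly w)
    rw [← X1_uField1_add_X2_uField2] at k
    have k2 := mul_le_mul_of_nonneg_left (uField_sq_add_sq_le h w) hs.le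
    have i4 : (1 + kaplanPoly w) ^ (h - 1) * ((w.1 ^ 2 + w.2.1 ^ 2) * kaplanPoly w)
        - 1 / 4 * (1 + kaplanPoly w) ^ (h - 1 / 2) * (w.1 ^ 2 + w.2.1 ^ 2) ^ 2 =
        uField1 h w * kaplanGrad1 w + uField2 h w * kaplanGrad2 w := by
      rw [← kaplanGrad_sq_add_sq, ← kaplanGrad_mul_add_mul, uField1, uField2]
      ring
    rw [i4] at k
    have young (x y : ℝ) : 2 * f w * x * y ≤ s * (f w ^ 2 * y ^ 2) + x ^ 2 / s := by
      have : s * (f w ^ 2 * y ^ 2) + x ^ 2 / s - 2 * f w * x * y = (s * (f w * y) - x) ^ 2 / s := by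
        field_simp; ring
      have : 0 ≤ (s * (f w * y) - x) ^ 2 / s := by positivity
      linarith
    have y1 := young (X1 f w) (uField1 h w)
    have y2 := young (X2 f w) (uField2 h w)
    have k3 := mul_le_mul_of_nonneg_left (show (1 + kaplanPoly w) ^ (h - 1 / 2) / 2 - C
      + s * (uField1 h w ^ 2 + uField2 h w ^ 2) ≤
      4 * h * kaplanPoly w ^ (h - 1) * (uField1 h w * kaplanGrad1 w + uField2 h w * kaplanGrad2 w)
      - (X1 (uField1 h) w + X2 (uField2 h) w) by linarith) (sq_nonneg (f w))
    have k4 : f w ^ 2 * (1 + kaplanPoly w) ^ (h - 1 / 2) ≤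
        2 / s * (X1 f w ^ 2 + X2 f w ^ 2) + 2 * C * f w ^ 2
        - 2 * (f w ^ 2 * (X1 (uField1 h) w + X2 (uField2 h) w
          - 4 * h * kaplanPoly w ^ (h - 1) *
            (uField1 h w * kaplanGrad1 w + uField2 h w * kaplanGrad2 w))
          + 2 * f w * X1 f w * uField1 h w + 2 * f w * X2 f w * uField2 h w) := by
      have e : 2 / s * (X1 f w ^ 2 + X2 f w ^ 2) = 2 * (X1 f w ^ 2 / s) + 2 * (X2 f w ^ 2 / s) := by
        ring
      rw [e]
      linarith
    have k5 := mul_le_mul_of_nonneg_right k4 (kaplanDensity_pos h w).le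
    linarith
  have hint := integral_mono intψ
    (((intE.const_mul (2 / s)).fun_add (intA.const_mul (2 * C))).sub ((int1.fun_add int2).const_mul 2))
    pointwise
  have hcalc : ∫ w, (2 / s * ((X1 f w ^ 2 + X2 f w ^ 2) * kaplanDensity h w)
          + 2 * C * (f w ^ 2 * kaplanDensity h w)
          - 2 * (X1 (fun w => f w ^ 2 * (kaplanDensity h w * uField1 h w)) w
            + X2 (fun w => f w ^ 2 * (kaplanDensity h w * uField2 h w)) w)) =
      2 / s * (∫ w, (X1 f w ^ 2 + X2 f w ^ 2) * kaplanDensity h w)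
        + 2 * C * ∫ w, f w ^ 2 * kaplanDensity h w := by
    rw [integral_sub ((intE.const_mul (2 / s)).fun_add (intA.const_mul (2 * C)))
      ((int1.fun_add int2).const_mul 2), integral_add (intE.const_mul (2 / s))
      (intA.const_mul (2 * C)), integral_const_mul, integral_const_mul, integral_const_mul,
      integral_add int1 int2, I1, I2]
    ring
  have hA0 : 0 ≤ ∫ w, f w ^ 2 * kaplanDensity h w :=
    integral_nonneg fun w => mul_nonneg (sq_nonneg _) (kaplanDensity_pos h w).le
  have hint' := hint.trans_eq hcalc
  linarith

end UBound

section SuperPoincare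

lemma integral_sq_mul_kaplanDensity_sq_le {h : ℝ} (hh : 1 / 2 < h) {f : ℝ × ℝ × ℝ → ℝ}
    (hf : ContDiff ℝ 1 f) (hc : HasCompactSupport f) {r : ℝ} (hr : 0 < r) :
    ∫ w, f w ^ 2 * kaplanDensity h w ^ 2 ≤
      24 * r ^ 2 * (2 * (∫ w, (X1 f w ^ 2 + X2 f w ^ 2) * kaplanDensity h w)
        + 96 * h ^ 2 * ∫ w, f w ^ 2 * kaplanDensity h w)
      + 2 / r ^ 4 * (∫ w, |f w| * kaplanDensity h w) ^ 2 := by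
  have hρ := contDiff_kaplanDensity hh
  have hρc := hρ.continuous
  have hfc := hf.continuous
  have hX1c := continuous_X1 hf
  have hX2c := continuous_X2 hf
  have hg : ContDiff ℝ 1 fun w => f w * kaplanDensity h w := hf.mul hρ
  have hgc : HasCompactSupport fun w => f w * kaplanDensity h w := hc.mul_right
  have hG1c := continuous_X1 hg
  have hG2c := continuous_X2 hg
  have intA : Integrable fun w => f w ^ 2 * kaplanDensity h w :=
    integrable_of_continuous_of_eq_zero (by fun_prop) hc fun w hw => by simp [hw]
  have intE1 : Integrable fun w => X1 f w ^ 2 * kaplanDensity h w :=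
    integrable_of_continuous_of_eq_zero (by fun_prop) (hasCompactSupport_X1 hc)
      fun w hw => by simp [hw]
  have intE2 : Integrable fun w => X2 f w ^ 2 * kaplanDensity h w :=
    integrable_of_continuous_of_eq_zero (by fun_prop) (hasCompactSupport_X2 hc)
      fun w hw => by simp [hw]
  have intE : Integrable fun w => (X1 f w ^ 2 + X2 f w ^ 2) * kaplanDensity h w := by
    simpa only [add_mul] using intE1.fun_add intE2
  have intG1 : Integrable fun w => X1 (fun w => f w * kaplanDensity h w) w ^ 2 :=
    integrable_of_continuous_of_eq_zero (by fun_prop) (hasCompactSupport_X1 hgc)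
      fun w hw => by simp [hw]
  have intG2 : Integrable fun w => X2 (fun w => f w * kaplanDensity h w) w ^ 2 :=
    integrable_of_continuous_of_eq_zero (by fun_prop) (hasCompactSupport_X2 hgc)
      fun w hw => by simp [hw]
  have nash := integral_sq_le_nash hg hgc hr
  simp only [mul_pow, abs_mul, abs_of_pos (kaplanDensity_pos _ _)] at nash
  refine nash.trans ?_
  gcongr
  calc ∫ w, (X1 (fun w => f w * kaplanDensity h w) w ^ 2
        + X2 (fun w => f w * kaplanDensity h w) w ^ 2)
      ≤ ∫ w, (2 * ((X1 f w ^ 2 + X2 f w ^ 2) * kaplanDensity h w)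
          + 96 * h ^ 2 * (f w ^ 2 * kaplanDensity h w)) := by
        refine integral_mono (intG1.fun_add intG2)
          ((intE.const_mul 2).fun_add (intA.const_mul _)) fun w => ?_
        have df := hf.differentiable one_ne_zero w
        have dρ := hρ.differentiable one_ne_zero w
        have hρ0 := kaplanDensity_pos h w
        have hρ1 : kaplanDensity h w ≤ 1 :=
          Real.exp_le_one_iff.2 (neg_nonpos.2 (Real.rpow_nonneg (kaplanPoly_nonneg w) h))
        have hV : (4 * h * kaplanPoly w ^ (h - 1)) ^ 2
            * ((w.1 ^ 2 + w.2.1 ^ 2) * kaplanPoly w) * kaplanDensity h w ≤ 48 * h ^ 2 :=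
          rpow_mul_exp_neg_rpow_le hh (kaplanPoly_nonneg w) (by positivity) (sq_le_kaplanPoly w)
        rw [← kaplanGrad_sq_add_sq] at hV
        have hV' := mul_le_mul_of_nonneg_left hV (mul_nonneg (sq_nonneg (f w)) hρ0.le)
        have hE : (X1 f w ^ 2 + X2 f w ^ 2) * kaplanDensity h w ^ 2 ≤
            (X1 f w ^ 2 + X2 f w ^ 2) * kaplanDensity h w := by
          gcongr
          nlinarith
        simp only [X1_mul df dρ, X2_mul df dρ, X1_kaplanDensity hh, X2_kaplanDensity hh]
        set k := 4 * h * kaplanPoly w ^ (h - 1)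
        set ρ := kaplanDensity h w
        have sq1 := sq_nonneg (f w * (-(k * kaplanGrad1 w) * ρ) - X1 f w * ρ)
        have sq2 := sq_nonneg (f w * (-(k * kaplanGrad2 w) * ρ) - X2 f w * ρ)
        linarith
    _ = _ := by
        rw [integral_add (intE.const_mul 2) (intA.const_mul _), integral_const_mul,
          integral_const_mul]

lemma exists_growth_bound {C₁ C₂ K α : ℝ} (hC₁ : 0 < C₁) (hC₂ : 0 < C₂) (hK : 0 ≤ K)
    (hα : 1 ≤ α) :
    ∃ C > 0, ∀ x > 0, 2304 * Real.exp (3 * (4 * C₁ * x + 4 * C₂) ^ α) * (8 * x + 8 * K) ^ 2 ≤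
      Real.exp (C * (1 + x ^ α)) := by
  refine ⟨3 * (8 * (C₁ + C₂)) ^ α + 2304 * (8 + 8 * K) ^ 2 + 4, by positivity, fun x hx => ?_⟩
  set y := x ^ α
  have hy : 0 < y := by positivity
  have hxy : x ≤ 1 + y := by
    rcases le_total x 1 with h1 | h1
    · linarith
    · have : x ^ (1 : ℝ) ≤ y := Real.rpow_le_rpow_of_exponent_le h1 hα
      rw [Real.rpow_one] at this
      linarith
  have h1 : (4 * C₁ * x + 4 * C₂) ^ α ≤ (8 * (C₁ + C₂)) ^ α * (1 + y) := by
    rcases le_total x 1 with hx1 | hx1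
    · calc (4 * C₁ * x + 4 * C₂) ^ α ≤ (8 * (C₁ + C₂)) ^ α := by
            refine Real.rpow_le_rpow (by positivity) ?_ (by linarith)
            nlinarith
        _ ≤ _ := le_mul_of_one_le_right (by positivity) (by linarith)
    · calc (4 * C₁ * x + 4 * C₂) ^ α ≤ (8 * (C₁ + C₂) * x) ^ α := by
            refine Real.rpow_le_rpow (by positivity) ?_ (by linarith)
            nlinarith
        _ = (8 * (C₁ + C₂)) ^ α * y := Real.mul_rpow (by positivity) hx.le
        _ ≤ _ := by gcongr; linarith
  have h2 : (8 * x + 8 * K) ^ 2 ≤ (8 + 8 * K) ^ 2 * Real.exp (4 * (1 + y)) := by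
    have e : Real.exp (4 * (1 + y)) = Real.exp (2 * (1 + y)) ^ 2 := by
      rw [← Real.exp_nat_mul]; push_cast; ring_nf
    rw [e, ← mul_pow]
    have := Real.add_one_le_exp (2 * (1 + y))
    have h3 : 1 + x ≤ Real.exp (2 * (1 + y)) := by linarith
    have h4 : 8 * x + 8 * K ≤ (8 + 8 * K) * (1 + x) := by nlinarith
    have h5 : (8 + 8 * K) * (1 + x) ≤ (8 + 8 * K) * Real.exp (2 * (1 + y)) := by gcongr
    exact pow_le_pow_left₀ (by positivity) (h4.trans h5) 2
  have h3 : 2304 * (8 + 8 * K) ^ 2 ≤ Real.exp (2304 * (8 + 8 * K) ^ 2 * (1 + y)) := by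
    have := Real.add_one_le_exp (2304 * (8 + 8 * K) ^ 2 * (1 + y))
    have : 0 ≤ 2304 * (8 + 8 * K) ^ 2 * y := by positivity
    linarith
  calc 2304 * Real.exp (3 * (4 * C₁ * x + 4 * C₂) ^ α) * (8 * x + 8 * K) ^ 2
      ≤ 2304 * Real.exp (3 * ((8 * (C₁ + C₂)) ^ α * (1 + y)))
        * ((8 + 8 * K) ^ 2 * Real.exp (4 * (1 + y))) := by gcongr
    _ = Real.exp (3 * ((8 * (C₁ + C₂)) ^ α * (1 + y))) * (2304 * (8 + 8 * K) ^ 2)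
        * Real.exp (4 * (1 + y)) := by ring
    _ ≤ Real.exp (3 * ((8 * (C₁ + C₂)) ^ α * (1 + y)))
        * Real.exp (2304 * (8 + 8 * K) ^ 2 * (1 + y)) * Real.exp (4 * (1 + y)) := by gcongr
    _ = _ := by
      rw [← Real.exp_add, ← Real.exp_add]
      ring_nf

/-- The super-Poincaré inequality for the unnormalised measure. -/
lemma exists_superPoincare {h : ℝ} (hh : 1 / 2 < h) :
    ∃ C > 0, ∀ ε > 0, ∀ f : ℝ × ℝ × ℝ → ℝ, ContDiff ℝ 1 f → HasCompactSupport f →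
      ∫ w, f w ^ 2 * kaplanDensity h w ≤
        ε * (∫ w, (X1 f w ^ 2 + X2 f w ^ 2) * kaplanDensity h w) +
          Real.exp (C * (1 + ε ^ (-(h / (h - 1 / 2))))) *
            (∫ w, |f w| * kaplanDensity h w) ^ 2 := by
  obtain ⟨C₁, hC₁, C₂, hC₂, hU⟩ := exists_uBound hh
  have hα : 1 ≤ h / (h - 1 / 2) := by
    rw [one_le_div (by linarith)]
    linarith
  set α := h / (h - 1 / 2) with hαdef
  have hh0 : 0 < h := by linarith
  obtain ⟨C, hC, hgrowth⟩ := exists_growth_bound hC₁ hC₂ (by positivity : 0 ≤ 48 * h ^ 2) hα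
  refine ⟨C, hC, fun ε hε f hf hc => ?_⟩
  have hρc := (contDiff_kaplanDensity hh).continuous
  have hψc := (contDiff_one_add_kaplanPoly_rpow (h - 1 / 2)).continuous
  have hfc := hf.continuous
  have intA : Integrable fun w => f w ^ 2 * kaplanDensity h w :=
    integrable_of_continuous_of_eq_zero (by fun_prop) hc fun w hw => by simp [hw]
  have intA2 : Integrable fun w => f w ^ 2 * kaplanDensity h w ^ 2 :=
    integrable_of_continuous_of_eq_zero (by fun_prop) hc fun w hw => by simp [hw]
  have intψ : Integrable fun w =>
      f w ^ 2 * ((1 + kaplanPoly w) ^ (h - 1 / 2) * kaplanDensity h w) :=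
    integrable_of_continuous_of_eq_zero (by fun_prop) hc fun w hw => by simp [hw]
  have hx : 0 < ε⁻¹ := inv_pos.2 hε
  have grow := hgrowth ε⁻¹ hx
  rw [Real.inv_rpow hε.le, ← Real.rpow_neg hε.le] at grow
  set M := 4 * C₁ * ε⁻¹ + 4 * C₂ with hM
  have hM0 : 0 < M := by positivity
  set H := M ^ α with hH
  set τ := 8 * ε⁻¹ + 8 * (48 * h ^ 2) with hτ
  have hτ0 : 0 < τ := by positivity
  set r := Real.sqrt (Real.exp (-H) / (24 * τ)) with hr
  have hr0 : 0 < r := Real.sqrt_pos.2 (by positivity)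
  have hr2 : r ^ 2 = Real.exp (-H) / (24 * τ) := Real.sq_sqrt (by positivity)
  have loc := integral_sq_mul_kaplanDensity_sq_le hh hf hc hr0
  have ub := hU f hf hc
  set A := ∫ w, f w ^ 2 * kaplanDensity h w with hA
  set E := ∫ w, (X1 f w ^ 2 + X2 f w ^ 2) * kaplanDensity h w with hE
  set L := ∫ w, |f w| * kaplanDensity h w with hL
  have hA0 : 0 ≤ A := integral_nonneg fun w => mul_nonneg (sq_nonneg _) (kaplanDensity_pos h w).le
  have hE0 : 0 ≤ E := integral_nonneg fun w =>
    mul_nonneg (add_nonneg (sq_nonneg _) (sq_nonneg _)) (kaplanDensity_pos h w).le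
  have split : A ≤ 1 / M * (∫ w, f w ^ 2 * ((1 + kaplanPoly w) ^ (h - 1 / 2) * kaplanDensity h w))
      + Real.exp H * ∫ w, f w ^ 2 * kaplanDensity h w ^ 2 := by
    rw [← integral_const_mul, ← integral_const_mul,
      ← integral_add (intψ.const_mul _) (intA2.const_mul _)]
    refine integral_mono intA ((intψ.const_mul _).fun_add (intA2.const_mul _)) fun w => ?_
    have := mul_le_mul_of_nonneg_left (exp_neg_rpow_le hh (kaplanPoly_nonneg w) hM0)
      (sq_nonneg (f w))
    refine this.trans_eq ?_
    simp only [kaplanDensity, ← hαdef, ← hH]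
    ring
  have far : 1 / M * (C₁ * E + C₂ * A) ≤ ε / 4 * E + 1 / 4 * A := by
    rw [one_div, inv_mul_le_iff₀ hM0]
    have : ε * ε⁻¹ = 1 := mul_inv_cancel₀ hε.ne'
    have e : M * (ε / 4 * E + 1 / 4 * A) = C₁ * E * (ε * ε⁻¹) + C₂ * A + C₁ * ε⁻¹ * A
        + C₂ * ε * E := by rw [hM]; ring
    have : 0 ≤ C₁ * ε⁻¹ * A + C₂ * ε * E := by positivity
    rw [e, mul_inv_cancel₀ hε.ne']
    linarith
  have near : Real.exp H * (24 * r ^ 2 * (2 * E + 96 * h ^ 2 * A)) ≤ ε / 4 * E + 1 / 4 * A := by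
    have e : Real.exp H * (24 * r ^ 2 * (2 * E + 96 * h ^ 2 * A)) =
        τ⁻¹ * (2 * E + 96 * h ^ 2 * A) := by
      rw [hr2, Real.exp_neg]
      field_simp
    rw [e, inv_mul_le_iff₀ hτ0]
    have e' : τ * (ε / 4 * E + 1 / 4 * A) = 2 * E * (ε * ε⁻¹) + 96 * h ^ 2 * A + 2 * ε⁻¹ * A
        + 96 * h ^ 2 * ε * E := by rw [hτ]; ring
    have : 0 ≤ 2 * ε⁻¹ * A + 96 * h ^ 2 * ε * E := by positivity
    rw [e', mul_inv_cancel₀ hε.ne']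
    linarith
  have tail : Real.exp H * (2 / r ^ 4 * L ^ 2) = 1152 * Real.exp (3 * H) * τ ^ 2 * L ^ 2 := by
    have e3 : Real.exp (3 * H) = Real.exp H ^ 3 := by
      rw [← Real.exp_nat_mul]; norm_num
    rw [show r ^ 4 = (r ^ 2) ^ 2 by ring, hr2, e3, Real.exp_neg]
    field_simp
    ring
  have b1 := mul_le_mul_of_nonneg_left ub (by positivity : 0 ≤ 1 / M)
  have b2 := mul_le_mul_of_nonneg_left loc (Real.exp_pos H).le
  have b3 := mul_le_mul_of_nonneg_right grow (sq_nonneg L)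
  rw [mul_add] at b2
  linarith

lemma integral_muH (p : ℝ) (F : ℝ × ℝ × ℝ → ℝ) :
    ∫ w, F w ∂(muH p) =
      (∫ v, kaplanDensity (p / 4) v)⁻¹ * ∫ w, F w * kaplanDensity (p / 4) w := by
  have e (w : ℝ × ℝ × ℝ) : Real.exp (-(KaplanH w) ^ p) = kaplanDensity (p / 4) w := by
    rw [KaplanH, kaplanDensity, ← kaplanPoly, ← Real.rpow_mul (kaplanPoly_nonneg w)]
    congr 3
    ring
  have hmeas : Measurable (kaplanDensity (p / 4)) := by
    unfold kaplanDensity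
    exact ((contDiff_kaplanPoly.continuous.measurable).pow_const _).neg.exp
  have hZ : 0 ≤ (∫ v, kaplanDensity (p / 4) v)⁻¹ :=
    inv_nonneg.2 (integral_nonneg fun v => (kaplanDensity_pos _ v).le)
  simp only [muH, e]
  rw [integral_withDensity_eq_integral_toReal_smul
    (hmeas.const_mul _).ennreal_ofReal
    (Filter.Eventually.of_forall fun _ => ENNReal.ofReal_lt_top), ← integral_const_mul]
  refine integral_congr_ae (Filter.Eventually.of_forall fun w => ?_)
  simp only [smul_eq_mul]
  rw [ENNReal.toReal_ofReal (mul_nonneg hZ (kaplanDensity_pos _ w).le)]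
  ring

end SuperPoincare

/-- The 2-super-Poincaré inequality for `dμ = Z⁻¹ e^{-N^p} dξ` on the Heisenberg group,
`p > 2`, with growth function `β₂(ε) ∼ exp(C ε^{-p/(p-2)})` and `ε₀ = 0`:
`∫ f² dμ ≤ ε ∫ |∇_ℍ f|² dμ + exp(C(1 + ε^{-p/(p-2)})) (∫ |f| dμ)²`. -/
theorem spi2_heisenberg (p : ℝ) (hp : 2 < p) :
    ∃ C > 0, ∀ ε > (0 : ℝ),
      ∀ f : ℝ × ℝ × ℝ → ℝ, ContDiff ℝ (⊤ : ℕ∞) f → HasCompactSupport f →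
      ∫ w, (f w) ^ 2 ∂(muH p) ≤
        ε * (∫ w, (X1 f w) ^ 2 + (X2 f w) ^ 2 ∂(muH p)) +
          Real.exp (C * (1 + ε ^ (-(p / (p - 2))))) * (∫ w, |f w| ∂(muH p)) ^ 2 := by
  obtain ⟨C, hC, spi⟩ := exists_superPoincare (h := p / 4) (by linarith)
  have hα : p / 4 / (p / 4 - 1 / 2) = p / (p - 2) := by
    rw [show p / 4 - 1 / 2 = (p - 2) / 4 by ring, div_div_div_cancel_right₀ (by norm_num)]
  rw [hα] at spi
  set c := (∫ v, kaplanDensity (p / 4) v)⁻¹ with hcdef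
  have hc0 : 0 ≤ c := inv_nonneg.2 (integral_nonneg fun v => (kaplanDensity_pos _ v).le)
  refine ⟨C + |Real.log c|, by positivity, fun ε hε f hf hsupp => ?_⟩
  simp only [integral_muH, ← hcdef]
  rcases hc0.eq_or_lt with hc | hc
  · simp [← hc]
  have key := mul_le_mul_of_nonneg_left
    (spi ε hε f (hf.of_le (by exact_mod_cast le_top)) hsupp) hc0
  set y := ε ^ (-(p / (p - 2)))
  have hy : 0 < y := by positivity
  have hexp : Real.exp (C * (1 + y)) ≤ c * Real.exp ((C + |Real.log c|) * (1 + y)) := by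
    refine (Real.exp_le_exp.2 ?_).trans_eq
      (by rw [Real.exp_add, Real.exp_log hc] :
        Real.exp (Real.log c + (C + |Real.log c|) * (1 + y)) = _)
    have := neg_abs_le (Real.log c)
    have : 0 ≤ |Real.log c| * y := by positivity
    linarith
  have key2 := mul_le_mul_of_nonneg_right hexp
    (mul_nonneg hc0 (sq_nonneg (∫ w, |f w| * kaplanDensity (p / 4) w)))
  linarith
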